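/- Let q ≥ 121 be an odd prime power and let E be an elliptic curve defined over F_q with j-invariant j(E) ≠ 0. Then the 3-elliptic code associated to E is non-extendable; equivalently, the point set φ₃(E(F_q)) = E(F_q) is a complete (n; 3, 1)-set (complete arc-type set with respect to lines counting 3-secants) in P²(F_q), i.e., through every F_q-rational point of P²(F_q) not on E there is a line meeting E(F_q) in 3 points. -/

import Mathlib

set_option linter.unusedSectionVars false

namespace NMDS

open WeierstrassCurve

variable {F : Type} [Field F] [Fintype F] [DecidableEq F]

/-- `ψ_i(X,Y)`: `Y^s` if `i = 3s` (`s ≥ 1`), `X·Y^s` if `i = 3s+2` (`s ≥ 0`),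
`X²·Y^s` if `i = 3s+4` (`s ≥ 0`). -/
def psi (i : ℕ) (X Y : F) : F :=
  if i % 3 = 0 then Y ^ (i / 3)
  else if i % 3 = 2 then X * Y ^ (i / 3)
  else X ^ 2 * Y ^ ((i - 4) / 3)

/-- The coordinate vector of `φ_k(P)`: `(1, ψ₂(P), …, ψ_k(P))` for an affine point `P`,
and `(0, …, 0, 1)` for the point at infinity. -/
def phiVec (W : WeierstrassCurve F) (k : ℕ) : W.toAffine.Point → (Fin k → F)
  | .zero => fun j => if (j : ℕ) = k - 1 then 1 else 0
  | .some (x := x) (y := y) _ => fun j => if (j : ℕ) = 0 then 1 else psi ((j : ℕ) + 1) x y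

lemma phiVec_ne_zero (W : WeierstrassCurve F) {k : ℕ} (hk : 0 < k)
    (P : W.toAffine.Point) : phiVec W k P ≠ 0 := by
  cases P with
  | zero =>
    intro h
    have := congrFun h ⟨k - 1, by omega⟩
    simp [phiVec] at this
  | some h' =>
    intro h
    have := congrFun h ⟨0, hk⟩
    simp [phiVec] at this

/-- The image of a rational point of `E` in `P^{k-1}(F_q)` under `φ_k`. -/
noncomputable def phiProj (W : WeierstrassCurve F) {k : ℕ} (hk : 0 < k)
    (P : W.toAffine.Point) : Projectivization F (Fin k → F) :=
  Projectivization.mk F (phiVec W k P) (phiVec_ne_zero W hk P)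

/-- The `k`-elliptic code associated to `E`, relative to an enumeration `e` of the `n`
rational points of `E`: the span of the rows of the `k × n` matrix whose `j`-th column
is `φ_k(P_j)`. -/
def ellipticCode (W : WeierstrassCurve F) (k : ℕ) {n : ℕ}
    (e : Fin n ≃ W.toAffine.Point) : Submodule F (Fin n → F) :=
  Submodule.span F (Set.range fun i : Fin k => fun j : Fin n => phiVec W k (e j) i)

/-- The minimum distance (= minimum weight) of a linear code. -/
noncomputable def minDist {n : ℕ} (C : Submodule F (Fin n → F)) : ℕ :=
  sInf {d | ∃ x ∈ C, x ≠ 0 ∧ hammingNorm x = d}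

/-- The standard inner product with `y` as a linear map. -/
def dotLin {n : ℕ} (y : Fin n → F) : (Fin n → F) →ₗ[F] F where
  toFun x := ∑ i, x i * y i
  map_add' a b := by simp [add_mul, Finset.sum_add_distrib]
  map_smul' c a := by simp [Finset.mul_sum, mul_assoc]

/-- The dual code: all vectors orthogonal to every codeword. -/
def dualCode {n : ℕ} (C : Submodule F (Fin n → F)) : Submodule F (Fin n → F) :=
  ⨅ y ∈ C, LinearMap.ker (dotLin y)

/-- The Singleton defect `s(C) = n - k + 1 - d` of a code of length `n`. -/
noncomputable def singletonDefect {n : ℕ} (C : Submodule F (Fin n → F)) : ℤ :=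
  (n : ℤ) + 1 - Module.finrank F C - minDist C

/-- A code is MDS if its Singleton defect is zero. -/
noncomputable def IsMDS {n : ℕ} (C : Submodule F (Fin n → F)) : Prop :=
  singletonDefect C = 0

/-- A code is near-MDS if both it and its dual have Singleton defect one. -/
noncomputable def IsNMDS {n : ℕ} (C : Submodule F (Fin n → F)) : Prop :=
  singletonDefect C = 1 ∧ singletonDefect (dualCode C) = 1

/-- An `[n,k,d]_q` code `C` is `h`-extendable if there is an `[n+h,k,d+h]_q` code `C'`
whose projection on the first `n` coordinates is `C`. -/
noncomputable def IsHExtendable {n : ℕ} (h : ℕ) (C : Submodule F (Fin n → F)) : Prop :=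
  ∃ C' : Submodule F (Fin (n + h) → F),
    Module.finrank F C' = Module.finrank F C ∧
    minDist C' = minDist C + h ∧
    Submodule.map (LinearMap.funLeft F F (Fin.castAdd h)) C' = C

/-- The point `p` of `P^{k-1}(F_q)` lies on the hyperplane with coefficient vector `a`. -/
def OnHyp {k : ℕ} (a : Fin k → F) (p : Projectivization F (Fin k → F)) : Prop :=
  ∑ i, a i * p.rep i = 0

/-- An `(·; k, k-2)`-set in `P^{k-1}(F_q)`: no `k+1` of its points lie on a common hyperplane,
i.e. every hyperplane contains at most `k` of its points. -/
def IsArcSet (k : ℕ) (S : Set (Projectivization F (Fin k → F))) : Prop :=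
  ∀ a : Fin k → F, a ≠ 0 → Set.ncard {p ∈ S | OnHyp a p} ≤ k

/-- A complete `(·; k, k-2)`-set: maximal with respect to set-theoretical inclusion. -/
def IsCompleteArcSet (k : ℕ) (S : Set (Projectivization F (Fin k → F))) : Prop :=
  IsArcSet k S ∧ ∀ T, IsArcSet k T → S ⊆ T → T = S

/-- Evaluation of the homogeneous cubic of a Weierstrass curve:
`Y²Z + a₁XYZ + a₃YZ² - X³ - a₂X²Z - a₄XZ² - a₆Z³`. -/
def cubicEval {R : Type*} [CommRing R] (W : WeierstrassCurve R) (x y z : R) : R :=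
  y ^ 2 * z + W.a₁ * x * y * z + W.a₃ * y * z ^ 2
    - (x ^ 3 + W.a₂ * x ^ 2 * z + W.a₄ * x * z ^ 2 + W.a₆ * z ^ 3)

/-- The gradient of the homogeneous cubic of a Weierstrass curve. -/
def gradEval {R : Type*} [CommRing R] (W : WeierstrassCurve R) (x y z : R) : Fin 3 → R :=
  ![W.a₁ * y * z - (3 * x ^ 2 + 2 * W.a₂ * x * z + W.a₄ * z ^ 2),
    2 * y * z + W.a₁ * x * z + W.a₃ * z ^ 2,
    y ^ 2 + W.a₁ * x * y + 2 * W.a₃ * y * z - (W.a₂ * x ^ 2 + 2 * W.a₄ * x * z + 3 * W.a₆ * z ^ 2)]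

/-- The point `p` of `P²(F_q)` lies on the plane cubic `E`. -/
def OnCurve (W : WeierstrassCurve F) (p : Projectivization F (Fin 3 → F)) : Prop :=
  cubicEval W (p.rep 0) (p.rep 1) (p.rep 2) = 0

/-- A line of `P²(F_q)`, given by its coefficient vector `l`, is a tangent of `E`:
it touches the curve at some point (over the algebraic closure) with multiplicity at
least two, i.e. it is the tangent line of the cubic at a contact point. -/
def IsTangentLine (W : WeierstrassCurve F) (l : Fin 3 → F) : Prop :=
  ∃ v : Fin 3 → AlgebraicClosure F, v ≠ 0 ∧
    cubicEval (W.baseChange (AlgebraicClosure F)) (v 0) (v 1) (v 2) = 0 ∧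
    (∑ i, algebraMap F (AlgebraicClosure F) (l i) * v i) = 0 ∧
    ∃ t : AlgebraicClosure F, t ≠ 0 ∧
      gradEval (W.baseChange (AlgebraicClosure F)) (v 0) (v 1) (v 2) =
        t • fun i => algebraMap F (AlgebraicClosure F) (l i)

/-- A line of `P²(F_q)` intersects `E` in three distinct `F_q`-rational points. -/
def IsThreeSecant (W : WeierstrassCurve F) (l : Fin 3 → F) : Prop :=
  ∃ u v w : Projectivization F (Fin 3 → F), u ≠ v ∧ u ≠ w ∧ v ≠ w ∧
    OnCurve W u ∧ OnCurve W v ∧ OnCurve W w ∧ OnHyp l u ∧ OnHyp l v ∧ OnHyp l w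

section

open Polynomial

section Stepanov
variable {K : Type*} [Field K]

lemma exists_lowest_block (π : ℕ) (J : ℕ) (s : ℕ → K[X]) (hs : ∃ j < J, s j ≠ 0) :
    ∃ M < J, s M ≠ 0 ∧ ∃ L : K[X],
      ∑ j ∈ Finset.range J, s j * X ^ (j * π) = X ^ (M * π) * (s M + X ^ π * L) := by
  induction J generalizing s with
  | zero => simp at hs
  | succ J ih =>
    by_cases h0 : s 0 = 0
    · obtain ⟨j, hj, hsj⟩ := hs
      obtain ⟨i, rfl⟩ : ∃ i, j = i + 1 :=
        Nat.exists_eq_succ_of_ne_zero (by rintro rfl; exact hsj h0)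
      obtain ⟨M, hM, hsM, L, hL⟩ := ih (fun k => s (k + 1)) ⟨i, by omega, hsj⟩
      refine ⟨M + 1, by omega, hsM, L, ?_⟩
      rw [Finset.sum_range_succ', h0]
      have : ∀ k, s (k + 1) * X ^ ((k + 1) * π) = X ^ π * (s (k + 1) * X ^ (k * π)) := by
        intro k; ring
      simp only [this, ← Finset.mul_sum, hL]
      ring
    · refine ⟨0, by omega, h0, ∑ j ∈ Finset.range J, s (j + 1) * X ^ (j * π), ?_⟩
      rw [Finset.sum_range_succ', Finset.mul_sum]
      have : ∀ k, s (k + 1) * X ^ ((k + 1) * π) = X ^ π * (s (k + 1) * X ^ (k * π)) := by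
        intro k; ring
      simp only [this]
      ring

lemma eq_zero_of_X_pow_dvd {π : ℕ} {a : K[X]} (h : X ^ π ∣ a) (ha : a.degree < π) : a = 0 :=
  eq_zero_of_dvd_of_degree_lt h (by simpa using ha)

lemma lowest_block_unique {π M N : ℕ} {a b L L' : K[X]} (ha : a ≠ 0) (hb : b ≠ 0)
    (hda : a.degree < π) (hdb : b.degree < π)
    (h : X ^ (M * π) * (a + X ^ π * L) = X ^ (N * π) * (b + X ^ π * L')) : a = b := by
  have key : ∀ {M N : ℕ} {a b L L' : K[X]}, a ≠ 0 → a.degree < π → M < N →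
      X ^ (M * π) * (a + X ^ π * L) = X ^ (N * π) * (b + X ^ π * L') → False := by
    intro M N a b L L' ha hda hMN h
    obtain ⟨k, rfl⟩ := Nat.exists_eq_add_of_lt hMN
    have h2 : a + X ^ π * L = X ^ π * (X ^ (k * π) * (b + X ^ π * L')) := by
      refine mul_left_cancel₀ (pow_ne_zero (M * π) X_ne_zero) (h.trans ?_)
      ring
    exact ha (eq_zero_of_X_pow_dvd ⟨X ^ (k * π) * (b + X ^ π * L') - L, by
      linear_combination h2⟩ hda)
  rcases lt_trichotomy M N with hlt | rfl | hlt
  · exact (key ha hda hlt h).elim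
  · have h2 := mul_left_cancel₀ (pow_ne_zero (M * π) X_ne_zero) h
    rw [← sub_eq_zero]
    refine eq_zero_of_X_pow_dvd ⟨L' - L, by linear_combination h2⟩ ?_
    exact (degree_sub_le _ _).trans_lt (max_lt hda hdb)
  · exact (key hb hdb hlt h.symm).elim

/-- The auxiliary polynomial of Stepanov's method does not vanish. -/
lemma stepanov_ne_zero {p : ℕ} [Fact p.Prime] [CharP K p] (k : ℕ) {f : K[X]}
    (hf : ∀ (c : K) (h : K[X]), f ≠ C c * h ^ 2) {e A J : ℕ} (hπ : p ^ k = 2 * e + 1)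
    (hA : f.natDegree + 2 * A ≤ p ^ k) (s u : ℕ → K[X]) (hs : ∀ j, (s j).degree < A)
    (hu : ∀ j, (u j).degree < A) (hsu : ∃ j < J, s j ≠ 0 ∨ u j ≠ 0) :
    ∑ j ∈ Finset.range J, (s j + u j * f ^ e) * X ^ (j * p ^ k) ≠ 0 := by
  intro h0
  set π := p ^ k with hπdef
  have hf0 : f ≠ 0 := by rintro rfl; exact hf 0 0 (by simp)
  set S := ∑ j ∈ Finset.range J, s j * X ^ (j * π) with hS
  set U := ∑ j ∈ Finset.range J, u j * X ^ (j * π) with hU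
  have hSU : S + U * f ^ e = 0 := by
    rw [← h0, hS, hU, Finset.sum_mul, ← Finset.sum_add_distrib]
    exact Finset.sum_congr rfl fun j _ => by ring
  have hApos : ∀ {g : K[X]}, g ≠ 0 → g.degree < A → g.natDegree + 1 ≤ A := fun {g} hg h => by
    rw [degree_eq_natDegree hg] at h
    exact_mod_cast h
  have hnz : ∀ (w : ℕ → K[X]), (∀ j, (w j).degree < A) → (∃ j < J, w j ≠ 0) →
      ∑ j ∈ Finset.range J, w j * X ^ (j * π) ≠ 0 := by
    intro w hw hex h
    obtain ⟨M, -, hwM, L, hL⟩ := exists_lowest_block π J w hex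
    rw [h] at hL
    have h2 := (mul_eq_zero.mp hL.symm).resolve_left (pow_ne_zero _ X_ne_zero)
    refine hwM (eq_zero_of_X_pow_dvd (π := π) ⟨-L, by linear_combination h2⟩ ?_)
    exact (hw M).trans_le (by exact_mod_cast (by omega))
  have hs0 : ∃ j < J, s j ≠ 0 := by
    by_contra! hcon
    have hS0 : S = 0 := Finset.sum_eq_zero fun j hj => by simp [hcon j (Finset.mem_range.mp hj)]
    obtain ⟨j, hj, hor⟩ := hsu
    refine hnz u hu ⟨j, hj, hor.resolve_left (not_not.mpr (hcon j hj))⟩ ?_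
    rw [hS0, zero_add] at hSU
    exact (mul_eq_zero.mp hSU).resolve_right (pow_ne_zero _ hf0)
  have hu0 : ∃ j < J, u j ≠ 0 := by
    by_contra! hcon
    have hU0 : U = 0 := Finset.sum_eq_zero fun j hj => by simp [hcon j (Finset.mem_range.mp hj)]
    rw [hU0, zero_mul, add_zero] at hSU
    exact hnz s hs hs0 hSU
  obtain ⟨M, -, hsM, L, hL⟩ := exists_lowest_block π J s hs0
  obtain ⟨N, -, huN, L', hL'⟩ := exists_lowest_block π J u hu0
  obtain ⟨g, hg, hgX⟩ := exists_eq_pow_rootMultiplicity_mul_and_not_dvd f hf0 0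
  set i := rootMultiplicity 0 f
  rw [C_0, sub_zero] at hg hgX
  have hga : g.coeff 0 ≠ 0 := fun h => hgX (X_dvd_iff.mpr h)
  have hfπ : f ^ π = X ^ (i * π) * (C (g.coeff 0 ^ π) + X ^ π * g.divX ^ π) := by
    conv_lhs => rw [hg, mul_pow, ← pow_mul, ← X_mul_divX_add g]
    rw [hπdef, add_pow_char_pow, mul_pow, C_pow]
    ring
  have hsq : f * S ^ 2 = U ^ 2 * f ^ π := by
    rw [hπ]
    linear_combination (f * S - f * U * f ^ e) * hSU
  rw [hS, hU, hL, hL', hfπ] at hsq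
  have hMA := hApos hsM (hs M)
  have hNA := hApos huN (hu N)
  have key : f * s M ^ 2 = C (g.coeff 0 ^ π) * u N ^ 2 := by
    refine lowest_block_unique (π := π) (M := 2 * M) (N := 2 * N + i)
      (L := f * (2 * s M * L + X ^ π * L ^ 2))
      (L' := C (g.coeff 0 ^ π) * (2 * u N * L' + X ^ π * L' ^ 2) +
        (u N + X ^ π * L') ^ 2 * g.divX ^ π) ?_ ?_ ?_ ?_ ?_
    · exact mul_ne_zero hf0 (pow_ne_zero _ hsM)
    · exact mul_ne_zero (C_ne_zero.mpr (pow_ne_zero _ hga)) (pow_ne_zero _ huN)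
    · refine (natDegree_lt_iff_degree_lt (mul_ne_zero hf0 (pow_ne_zero _ hsM))).mp ?_
      rw [natDegree_mul hf0 (pow_ne_zero _ hsM), natDegree_pow]
      omega
    · refine (natDegree_lt_iff_degree_lt
        (mul_ne_zero (C_ne_zero.mpr (pow_ne_zero _ hga)) (pow_ne_zero _ huN))).mp ?_
      rw [natDegree_C_mul (pow_ne_zero _ hga), natDegree_pow]
      omega
    · linear_combination hsq
  have hdvd : s M ∣ u N := by
    refine (UniqueFactorizationMonoid.pow_dvd_pow_iff_dvd two_ne_zero).mp ?_
    refine ⟨C ((g.coeff 0 ^ π)⁻¹) * f, ?_⟩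
    have : C ((g.coeff 0 ^ π)⁻¹) * C (g.coeff 0 ^ π) = (1 : K[X]) := by
      rw [← C_mul, inv_mul_cancel₀ (pow_ne_zero _ hga), C_1]
    linear_combination (-C ((g.coeff 0 ^ π)⁻¹)) * key - u N ^ 2 * this
  obtain ⟨h, hh⟩ := hdvd
  refine hf (g.coeff 0 ^ π) h (mul_right_cancel₀ (pow_ne_zero 2 hsM) ?_)
  rw [key, hh]
  ring

/-- The auxiliary system of Stepanov's method has a nonzero solution. -/
lemma exists_stepanov_coeffs [Finite K] {p : ℕ} [Fact p.Prime] [CharP K p] (k : ℕ) (f : K[X])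
    {e A J : ℕ} (hJ : p ^ k * A + f.natDegree * e + J < 2 * (A * J)) :
    ∃ s u : ℕ → K[X], (∀ j, (s j).degree < A) ∧ (∀ j, (u j).degree < A) ∧
      (∃ j < J, s j ≠ 0 ∨ u j ≠ 0) ∧
      ∑ j ∈ Finset.range J, (s j ^ p ^ k * f ^ e + u j ^ p ^ k) * X ^ j = 0 := by
  classical
  set π := p ^ k with hπ
  set B := π * A + f.natDegree * e + J
  let V := (Fin J → degreeLT K A) × (Fin J → degreeLT K A)
  have hApos : 0 < A := by
    rcases Nat.eq_zero_or_pos A with rfl | h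
    · simp at hJ
    · exact h
  have hdeg : ∀ (w : V) (j : Fin J),
      ((((w.1 j : K[X]) ^ π * f ^ e + (w.2 j : K[X]) ^ π) * X ^ (j : ℕ)) : K[X]) ∈
        degreeLT K B := by
    intro w j
    have hw : ∀ g : degreeLT K A, (g : K[X]).natDegree ≤ A - 1 := by
      intro g
      have := mem_degreeLT.mp g.2
      by_cases hg : (g : K[X]) = 0
      · simp [hg]
      · have := (natDegree_lt_iff_degree_lt hg).mpr this
        omega
    have hpow : ∀ g : degreeLT K A, ((g : K[X]) ^ π).natDegree ≤ π * (A - 1) := fun g =>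
      natDegree_pow_le.trans (Nat.mul_le_mul_left _ (hw g))
    have h1 : (((w.1 j : K[X]) ^ π * f ^ e + (w.2 j : K[X]) ^ π) * X ^ (j : ℕ)).natDegree ≤
        π * (A - 1) + f.natDegree * e + j := by
      refine natDegree_mul_le.trans ?_
      rw [natDegree_X_pow]
      refine Nat.add_le_add_right (natDegree_add_le_of_degree_le ?_ ?_) _
      · refine natDegree_mul_le.trans (Nat.add_le_add (hpow _) ?_)
        rw [mul_comm]
        exact natDegree_pow_le
      · exact (hpow _).trans (Nat.le_add_right _ _)
    have h2 : π * (A - 1) ≤ π * A := Nat.mul_le_mul_left _ (Nat.sub_le _ _)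
    have h3 := j.2
    rw [mem_degreeLT]
    exact degree_le_natDegree.trans_lt (by exact_mod_cast (by omega))
  let Φ : V → degreeLT K B := fun w => ∑ j : Fin J, ⟨_, hdeg w j⟩
  have hcard : ∀ n, Nat.card (degreeLT K n) = Nat.card K ^ n := fun n => by
    rw [Nat.card_congr (degreeLTEquiv K n).toEquiv, Nat.card_fun, Nat.card_fin]
  have hfin : ∀ n, Finite (degreeLT K n) := fun n =>
    Finite.of_equiv _ (degreeLTEquiv K n).toEquiv.symm
  have hninj : ¬ Function.Injective Φ := by
    intro hinj
    have := Nat.card_le_card_of_injective Φ hinj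
    rw [Nat.card_prod, Nat.card_fun, hcard, hcard, Nat.card_fin, ← pow_mul, ← pow_add] at this
    have h2 := (Nat.pow_le_pow_iff_right (Finite.one_lt_card (α := K))).mp this
    omega
  rw [Function.not_injective_iff] at hninj
  obtain ⟨w, w', hΦ, hne⟩ := hninj
  have hΦ' : ∑ j : Fin J, (((w.1 j : K[X]) ^ π * f ^ e + (w.2 j : K[X]) ^ π) * X ^ (j : ℕ)) =
      ∑ j : Fin J, (((w'.1 j : K[X]) ^ π * f ^ e + (w'.2 j : K[X]) ^ π) * X ^ (j : ℕ)) := by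
    simpa [Φ] using congrArg (Subtype.val) hΦ
  have hdiff : ∀ a : degreeLT K A, (a : K[X]).degree < A := fun a => mem_degreeLT.mp a.2
  refine ⟨fun j => if h : j < J then ((w.1 - w'.1) ⟨j, h⟩ : degreeLT K A) else 0,
    fun j => if h : j < J then ((w.2 - w'.2) ⟨j, h⟩ : degreeLT K A) else 0, ?_, ?_, ?_, ?_⟩
  · intro j
    dsimp only
    split_ifs
    · exact hdiff _
    · simp
  · intro j
    dsimp only
    split_ifs
    · exact hdiff _
    · simp
  · by_contra! hcon
    refine hne (Prod.ext (funext fun j => ?_) (funext fun j => ?_))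
    · simpa [sub_eq_zero] using (hcon j j.2).1
    · simpa [sub_eq_zero] using (hcon j j.2).2
  · rw [Finset.sum_range]
    rw [← sub_eq_zero, ← Finset.sum_sub_distrib] at hΦ'
    rw [← hΦ']
    refine Finset.sum_congr rfl fun j _ => ?_
    simp only [Fin.is_lt, dif_pos, Pi.sub_apply, AddSubgroupClass.coe_sub, Fin.eta]
    rw [hπ, sub_pow_char_pow, sub_pow_char_pow]
    ring

/-- Stepanov's bound for the number of points at which a polynomial takes a nonzero square
value, over a field whose cardinality is a square. -/
lemma stepanov_card_le [Fintype K] [DecidableEq K] {p : ℕ} [Fact p.Prime] [CharP K p] (k : ℕ)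
    (hK : Fintype.card K = (p ^ k) ^ 2) {f : K[X]} (hf : ∀ (c : K) (h : K[X]), f ≠ C c * h ^ 2)
    {e A J : ℕ} (hπ : p ^ k = 2 * e + 1) (hA : f.natDegree + 2 * A ≤ p ^ k)
    (hJ : p ^ k * A + f.natDegree * e + J < 2 * (A * J)) :
    (Finset.univ.filter fun x : K => f.eval x ^ (Fintype.card K / 2) = 1).card ≤
      A + f.natDegree * e + J * p ^ k := by
  obtain ⟨s, u, hs, hu, hsu, h0⟩ := exists_stepanov_coeffs (p := p) k f hJ
  have hT := stepanov_ne_zero k hf hπ hA s u hs hu hsu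
  set T := ∑ j ∈ Finset.range J, (s j + u j * f ^ e) * X ^ (j * p ^ k) with hTdef
  have hdegT : T.natDegree ≤ A + f.natDegree * e + J * p ^ k := by
    refine natDegree_sum_le_of_forall_le _ _ fun j hj => ?_
    have hj' := Finset.mem_range.mp hj
    have hle : ∀ g : K[X], g.degree < A → g.natDegree ≤ A := fun g hg =>
      natDegree_le_of_degree_le hg.le
    refine natDegree_mul_le.trans (Nat.add_le_add (natDegree_add_le_of_degree_le ?_ ?_) ?_)
    · exact (hle _ (hs j)).trans (Nat.le_add_right _ _)
    · refine natDegree_mul_le.trans (Nat.add_le_add (hle _ (hu j)) ?_)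
      rw [mul_comm]
      exact natDegree_pow_le
    · rw [natDegree_X_pow]
      exact Nat.mul_le_mul_right _ hj'.le
  refine le_trans ?_ hdegT
  refine le_trans (Finset.card_le_card ?_) ((Multiset.toFinset_card_le _).trans (card_roots' T))
  intro x hx
  rw [Finset.mem_filter] at hx
  rw [Multiset.mem_toFinset, mem_roots hT, IsRoot.def]
  set π := p ^ k
  have hcard : Fintype.card K / 2 = e * π + e := by
    rw [hK, hπ]
    have : (2 * e + 1) ^ 2 = 2 * (e * (2 * e + 1) + e) + 1 := by ring
    omega
  have hx2 : f.eval x ^ (e * π) * f.eval x ^ e = 1 := by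
    rw [← pow_add, ← hcard]
    exact hx.2
  have hfx : f.eval x ^ e ≠ 0 := right_ne_zero_of_mul_eq_one hx2
  have hxπ : ∀ j : ℕ, (x ^ (j * π)) ^ π = x ^ j := by
    intro j
    rw [← pow_mul, mul_assoc, ← sq, ← hK, mul_comm, pow_mul, FiniteField.pow_card]
  have hTx : T.eval x ^ π * f.eval x ^ e = 0 := by
    rw [hTdef, eval_finsetSum, sum_pow_char_pow, Finset.sum_mul]
    have h1 := congrArg (eval x) h0
    rw [eval_finsetSum, eval_zero] at h1
    rw [← h1]
    refine Finset.sum_congr rfl fun j _ => ?_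
    simp only [eval_mul, eval_add, eval_pow, eval_X]
    rw [mul_pow, hxπ, add_pow_char_pow, mul_pow, ← pow_mul]
    linear_combination (x ^ j * (u j).eval x ^ π) * hx2
  exact eq_zero_of_pow_eq_zero ((mul_eq_zero.mp hTx).resolve_right hfx)

end Stepanov

lemma natDegree_ne_zero_of_not_const_mul_sq {K : Type*} [Field K] {f : K[X]}
    (hf : ∀ (c : K) (h : K[X]), f ≠ C c * h ^ 2) : f.natDegree ≠ 0 := fun h =>
  hf (f.coeff 0) 1 (by rw [one_pow, mul_one]; exact eq_C_of_natDegree_eq_zero h)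

lemma card_filter_eval_eq_zero_le {K : Type*} [Field K] [Fintype K] [DecidableEq K] {f : K[X]}
    (hf : f ≠ 0) : (Finset.univ.filter fun x : K => f.eval x = 0).card ≤ f.natDegree := by
  refine le_trans (Finset.card_le_card ?_) ((Multiset.toFinset_card_le _).trans (card_roots' f))
  intro x hx
  rw [Finset.mem_filter] at hx
  rw [Multiset.mem_toFinset, mem_roots hf]
  exact hx.2

lemma sum_quadraticChar_le_of_card_eq_sq {K : Type*} [Field K] [Fintype K] [DecidableEq K]
    {p : ℕ} [Fact p.Prime] [CharP K p] (k : ℕ) (hK : Fintype.card K = (p ^ k) ^ 2)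
    (h2 : ringChar K ≠ 2) {f : K[X]} (hf : ∀ (c : K) (h : K[X]), f ≠ C c * h ^ 2)
    (hd : 4 * f.natDegree + 13 ≤ p ^ k) :
    ∑ x : K, quadraticChar K (f.eval x) ≤ (4 * f.natDegree + 7) * (p ^ k : ℤ) := by
  have hodd : p ^ k % 2 = 1 := by
    have := FiniteField.odd_card_of_char_ne_two h2
    rw [hK] at this
    rcases Nat.mod_two_eq_zero_or_one (p ^ k) with h | h
    · rw [Nat.pow_mod, h] at this; simp at this
    · exact h
  obtain ⟨e, he⟩ : ∃ e, p ^ k = 2 * e + 1 := ⟨p ^ k / 2, by omega⟩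
  set d := f.natDegree with hddef
  have hde : 2 * d + 6 ≤ e := by omega
  obtain ⟨A, hA⟩ := Nat.exists_eq_add_of_le (show d ≤ e by omega)
  have hN := stepanov_card_le k hK hf (A := A) (J := e + d + 3) he
    (by rw [← hddef]; omega) (by
      rw [← hddef, he]
      nlinarith [Nat.zero_le d])
  rw [← hddef] at hN
  have hZ := card_filter_eval_eq_zero_le (f := f) (by rintro rfl; exact hf 0 0 (by simp))
  have hpt : ∀ a : K, quadraticChar K a ≤
      2 * (if a ^ (Fintype.card K / 2) = 1 then 1 else 0) - 1 + (if a = 0 then 1 else 0) := by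
    intro a
    by_cases ha : a = 0
    · subst ha
      simp only [quadraticChar_zero, if_true]
      split_ifs <;> norm_num
    · have h1 := (quadraticChar_one_iff_isSquare ha).trans (FiniteField.isSquare_iff h2 ha)
      rw [if_neg ha]
      simp only [← h1]
      rcases quadraticChar_dichotomy ha with h | h <;> simp [h]
  have hsum : ∑ x : K, quadraticChar K (f.eval x) ≤
      2 * ((Finset.univ.filter fun x : K => f.eval x ^ (Fintype.card K / 2) = 1).card : ℤ) -
        (Fintype.card K : ℤ) + ((Finset.univ.filter fun x : K => f.eval x = 0).card : ℤ) := by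
    refine (Finset.sum_le_sum fun x _ => hpt (f.eval x)).trans (le_of_eq ?_)
    rw [Finset.sum_add_distrib, Finset.sum_sub_distrib, ← Finset.mul_sum]
    simp
  refine hsum.trans ?_
  have hN' : ((Finset.univ.filter fun x : K => f.eval x ^ (Fintype.card K / 2) = 1).card : ℤ) ≤
      A + d * e + (e + d + 3) * (p ^ k : ℤ) := by exact_mod_cast hN
  have hZ' : ((Finset.univ.filter fun x : K => f.eval x = 0).card : ℤ) ≤ d := by exact_mod_cast hZ
  have hKz : (Fintype.card K : ℤ) = (p ^ k : ℤ) ^ 2 := by exact_mod_cast hK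
  have he' : (p ^ k : ℤ) = 2 * e + 1 := by exact_mod_cast he
  have hA' : (e : ℤ) = d + A := by exact_mod_cast hA
  have hde' : 2 * (d : ℤ) + 6 ≤ e := by exact_mod_cast hde
  rw [he'] at hN' hKz ⊢
  nlinarith

lemma abs_sum_quadraticChar_le_of_card_eq_sq {K : Type*} [Field K] [Fintype K] [DecidableEq K]
    {p : ℕ} [Fact p.Prime] [CharP K p] (k : ℕ) (hK : Fintype.card K = (p ^ k) ^ 2)
    (h2 : ringChar K ≠ 2) {f : K[X]} (hf : ∀ (c : K) (h : K[X]), f ≠ C c * h ^ 2)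
    (hd : 4 * f.natDegree + 13 ≤ p ^ k) :
    |∑ x : K, quadraticChar K (f.eval x)| ≤ (4 * f.natDegree + 7) * (p ^ k : ℤ) := by
  refine abs_le.mpr ⟨?_, sum_quadraticChar_le_of_card_eq_sq k hK h2 hf hd⟩
  obtain ⟨ν, hν⟩ := quadraticChar_exists_neg_one h2
  have hν0 : ν ≠ 0 := by rintro rfl; simp at hν
  have hdeg : (C ν * f).natDegree = f.natDegree := natDegree_C_mul hν0
  have hνf : ∀ (c : K) (h : K[X]), C ν * f ≠ C c * h ^ 2 := by
    intro c h heq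
    refine hf (ν⁻¹ * c) h ?_
    rw [C_mul, mul_assoc, ← heq, ← mul_assoc, ← C_mul, inv_mul_cancel₀ hν0, C_1, one_mul]
  have := sum_quadraticChar_le_of_card_eq_sq k hK h2 hνf (by rwa [hdeg])
  rw [hdeg] at this
  simp only [eval_mul, eval_C, map_mul, hν, neg_one_mul, Finset.sum_neg_distrib] at this
  linarith

section MonicSums

variable {K : Type*} [Field K] [Finite K]

lemma finite_monic_natDegree_eq (K : Type*) [Field K] [Finite K] (m : ℕ) :
    {g : K[X] | g.Monic ∧ g.natDegree = m}.Finite := by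
  have : Finite (degreeLT K (m + 1)) := Finite.of_equiv _ (degreeLTEquiv K (m + 1)).symm.toEquiv
  refine Set.Finite.subset (Set.toFinite (degreeLT K (m + 1) : Set K[X])) ?_
  rintro g ⟨-, hg⟩
  rw [SetLike.mem_coe, mem_degreeLT]
  exact degree_le_natDegree.trans_lt (by rw [hg]; exact_mod_cast Nat.lt_succ_self m)

/-- The monic polynomials of degree `m` over a finite field. -/
noncomputable def monics (K : Type*) [Field K] [Finite K] (m : ℕ) : Finset K[X] :=
  (finite_monic_natDegree_eq K m).toFinset

lemma mem_monics {m : ℕ} {g : K[X]} : g ∈ monics K m ↔ g.Monic ∧ g.natDegree = m := by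
  simp [monics]

open scoped Classical in
/-- The monic irreducible polynomials of degree at most `m` over a finite field. -/
noncomputable def monicIrreducibles (K : Type*) [Field K] [Finite K] (m : ℕ) : Finset K[X] :=
  ((Finset.range (m + 1)).biUnion (monics K)).filter Irreducible

lemma mem_monicIrreducibles {m : ℕ} {g : K[X]} :
    g ∈ monicIrreducibles K m ↔ g.Monic ∧ Irreducible g ∧ g.natDegree ≤ m := by
  simp only [monicIrreducibles, mem_monics, Finset.mem_filter, Finset.mem_biUnion,
    Finset.mem_range, Nat.lt_succ_iff]
  constructor
  · rintro ⟨⟨a, ha, hg, rfl⟩, hi⟩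
    exact ⟨hg, hi, ha⟩
  · rintro ⟨hg, hi, hm⟩
    exact ⟨⟨_, hm, hg, rfl⟩, hi⟩

lemma monics_zero : monics K 0 = {1} := by
  ext g
  rw [mem_monics, Finset.mem_singleton]
  exact ⟨fun h => h.1.natDegree_eq_zero.mp h.2, by rintro rfl; simp⟩

open scoped Classical in
lemma sum_natDegree_mul_card_pow_dvd {g : K[X]} (hg : g.Monic) :
    ∑ P ∈ monicIrreducibles K g.natDegree, P.natDegree *
      ((Finset.Icc 1 g.natDegree).filter fun k => P ^ k ∣ g).card = g.natDegree := by
  have hcount : ∀ P ∈ monicIrreducibles K g.natDegree,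
      ((Finset.Icc 1 g.natDegree).filter fun k => P ^ k ∣ g).card =
        (UniqueFactorizationMonoid.normalizedFactors g).count P := by
    intro P hP
    rw [mem_monicIrreducibles] at hP
    obtain ⟨hPm, hPi, -⟩ := hP
    have key : ∀ k, P ^ k ∣ g ↔ k ≤ (UniqueFactorizationMonoid.normalizedFactors g).count P := by
      intro k
      rw [pow_dvd_iff_le_emultiplicity,
        UniqueFactorizationMonoid.le_emultiplicity_iff_replicate_le_normalizedFactors hPi hg.ne_zero,
        hPm.normalize_eq_self, Multiset.le_count_iff_replicate_le]
    have hle : (UniqueFactorizationMonoid.normalizedFactors g).count P ≤ g.natDegree := by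
      have h1 := natDegree_le_of_dvd ((key _).mpr le_rfl) hg.ne_zero
      rw [natDegree_pow] at h1
      exact (Nat.le_mul_of_pos_right _ hPi.natDegree_pos).trans h1
    have : ((Finset.Icc 1 g.natDegree).filter fun k => P ^ k ∣ g) =
        Finset.Icc 1 ((UniqueFactorizationMonoid.normalizedFactors g).count P) := by
      ext k
      rw [Finset.mem_filter, key, Finset.mem_Icc, Finset.mem_Icc]
      omega
    rw [this, Nat.card_Icc, Nat.add_sub_cancel]
  rw [Finset.sum_congr rfl fun P hP => by rw [hcount P hP]]
  have hprod : (UniqueFactorizationMonoid.normalizedFactors g).prod = g := by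
    have h1 := UniqueFactorizationMonoid.prod_normalizedFactors_eq hg.ne_zero
    rwa [hg.normalize_eq_self] at h1
  have hmon : ∀ P ∈ UniqueFactorizationMonoid.normalizedFactors g, P.Monic := fun P hP => by
    have h1 := UniqueFactorizationMonoid.normalize_normalized_factor P hP
    have h2 := UniqueFactorizationMonoid.ne_zero_of_mem_normalizedFactors hP
    rw [← h1]
    exact monic_normalize h2
  have hdeg : g.natDegree =
      ((UniqueFactorizationMonoid.normalizedFactors g).map natDegree).sum := by
    conv_lhs => rw [← hprod]
    exact natDegree_multiset_prod_of_monic _ hmon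
  conv_rhs => rw [hdeg]
  rw [Finset.sum_multiset_map_count]
  symm
  refine Finset.sum_subset_zero_on_sdiff ?_ ?_ ?_
  · intro P hP
    rw [Multiset.mem_toFinset] at hP
    rw [mem_monicIrreducibles]
    exact ⟨hmon P hP, UniqueFactorizationMonoid.irreducible_of_normalized_factor P hP,
      natDegree_le_of_dvd (UniqueFactorizationMonoid.dvd_of_mem_normalizedFactors hP) hg.ne_zero⟩
  · intro P hP
    rw [Finset.mem_sdiff, Multiset.mem_toFinset] at hP
    rw [Multiset.count_eq_zero_of_notMem hP.2, mul_zero]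
  · intro P _
    rw [smul_eq_mul, mul_comm]

/-- The sum of a multiplicative function over the monic polynomials of degree `m`. -/
noncomputable def monicSum (φ : K[X] →* ℤ) (m : ℕ) : ℤ := ∑ g ∈ monics K m, φ g

/-- The coefficients of the logarithmic derivative of the generating series of `monicSum φ`. -/
noncomputable def primePowerSum (φ : K[X] →* ℤ) (r : ℕ) : ℤ :=
  ∑ P ∈ monicIrreducibles K r, if P.natDegree ∣ r then P.natDegree * φ P ^ (r / P.natDegree) else 0

lemma monicSum_zero (φ : K[X] →* ℤ) : monicSum φ 0 = 1 := by
  rw [monicSum, monics_zero, Finset.sum_singleton, map_one]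

lemma sum_monics_filter_dvd (φ : K[X] →* ℤ) {Q : K[X]} (hQ : Q.Monic) {m : ℕ}
    (hm : Q.natDegree ≤ m) [DecidablePred fun g : K[X] => Q ∣ g] :
    ∑ g ∈ (monics K m).filter (fun g => Q ∣ g), φ g = φ Q * monicSum φ (m - Q.natDegree) := by
  rw [monicSum, Finset.mul_sum]
  symm
  refine Finset.sum_bij (fun h _ => Q * h) ?_ ?_ ?_ ?_
  · intro h hh
    rw [mem_monics] at hh
    rw [Finset.mem_filter, mem_monics]
    exact ⟨⟨hQ.mul hh.1, by rw [hQ.natDegree_mul hh.1, hh.2]; omega⟩, dvd_mul_right _ _⟩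
  · intro a _ b _ hab
    exact mul_left_cancel₀ hQ.ne_zero hab
  · intro g hg
    rw [Finset.mem_filter, mem_monics] at hg
    obtain ⟨⟨hgm, hgd⟩, h, rfl⟩ := hg
    have hh : h.Monic := hQ.of_mul_monic_left hgm
    refine ⟨h, ?_, rfl⟩
    rw [mem_monics]
    refine ⟨hh, ?_⟩
    rw [hQ.natDegree_mul hh] at hgd
    omega
  · intro h _
    rw [map_mul]

lemma natCast_mul_monicSum (φ : K[X] →* ℤ) (m : ℕ) :
    m * monicSum φ m = ∑ r ∈ Finset.Icc 1 m, primePowerSum φ r * monicSum φ (m - r) := by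
  classical
  have hS : ∀ r ∈ Finset.Icc 1 m, primePowerSum φ r = ∑ P ∈ monicIrreducibles K m,
      ∑ k ∈ Finset.Icc 1 m, if k * P.natDegree = r then P.natDegree * φ P ^ k else 0 := by
    intro r hr
    rw [Finset.mem_Icc] at hr
    have hsub : monicIrreducibles K r ⊆ monicIrreducibles K m := fun P hP => by
      rw [mem_monicIrreducibles] at hP ⊢
      exact ⟨hP.1, hP.2.1, hP.2.2.trans hr.2⟩
    rw [primePowerSum]
    refine Finset.sum_subset_zero_on_sdiff hsub ?_ ?_
    · intro P hP
      rw [Finset.mem_sdiff, mem_monicIrreducibles, mem_monicIrreducibles] at hP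
      refine Finset.sum_eq_zero fun k hk => if_neg fun h => hP.2 ⟨hP.1.1, hP.1.2.1, ?_⟩
      rw [Finset.mem_Icc] at hk
      rw [← h]
      exact Nat.le_mul_of_pos_left _ hk.1
    · intro P hP
      rw [mem_monicIrreducibles] at hP
      have hpos := hP.2.1.natDegree_pos
      split_ifs with hd
      · obtain ⟨k, rfl⟩ := hd
        rw [Nat.mul_div_cancel_left _ hpos, Finset.sum_eq_single_of_mem k, if_pos (mul_comm _ _)]
        · rw [Finset.mem_Icc]
          refine ⟨Nat.pos_of_ne_zero (by rintro rfl; simp at hr), ?_⟩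
          exact (Nat.le_mul_of_pos_left _ hpos).trans hr.2
        · intro j _ hj
          refine if_neg fun h => hj ?_
          rw [mul_comm] at h
          exact Nat.eq_of_mul_eq_mul_left hpos h
      · refine (Finset.sum_eq_zero fun k _ => if_neg fun h => hd ?_).symm
        exact ⟨k, by rw [← h, mul_comm]⟩
  rw [Finset.sum_congr rfl fun r hr => by rw [hS r hr]]
  have hg : (m : ℤ) * monicSum φ m = ∑ g ∈ monics K m, ∑ P ∈ monicIrreducibles K m,
      ∑ k ∈ Finset.Icc 1 m, if P ^ k ∣ g then (P.natDegree : ℤ) * φ g else 0 := by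
    rw [monicSum, Finset.mul_sum]
    refine Finset.sum_congr rfl fun g hg => ?_
    rw [mem_monics] at hg
    have h1 := sum_natDegree_mul_card_pow_dvd hg.1
    rw [hg.2] at h1
    conv_lhs => rw [← h1]
    push_cast
    rw [Finset.sum_mul]
    refine Finset.sum_congr rfl fun P _ => ?_
    rw [← Finset.sum_filter, Finset.sum_const, nsmul_eq_mul]
    ring
  rw [hg, Finset.sum_comm]
  simp only [Finset.sum_mul]
  rw [Finset.sum_comm (s := Finset.Icc 1 m)]
  refine Finset.sum_congr rfl fun P hP => ?_
  rw [mem_monicIrreducibles] at hP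
  rw [Finset.sum_comm, Finset.sum_comm (s := Finset.Icc 1 m) (t := Finset.Icc 1 m)]
  refine Finset.sum_congr rfl fun k hk => ?_
  rw [Finset.mem_Icc] at hk
  have hpos := hP.2.1.natDegree_pos
  have hPk : (P ^ k).natDegree = k * P.natDegree := natDegree_pow P k
  rw [← Finset.sum_filter]
  by_cases hle : k * P.natDegree ≤ m
  · rw [← Finset.mul_sum, sum_monics_filter_dvd φ (hP.1.pow k) (by rw [hPk]; exact hle), hPk,
      Finset.sum_eq_single_of_mem (k * P.natDegree), if_pos rfl, map_pow, mul_assoc]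
    · rw [Finset.mem_Icc]
      exact ⟨Nat.mul_pos hk.1 hpos, hle⟩
    · intro r _ hr
      rw [if_neg (Ne.symm hr), zero_mul]
  · rw [Finset.sum_eq_zero, Finset.sum_eq_zero]
    · intro r hr
      rw [Finset.mem_Icc] at hr
      rw [if_neg (by omega), zero_mul]
    · intro g hg
      rw [Finset.mem_filter, mem_monics] at hg
      have h1 := natDegree_le_of_dvd hg.2 hg.1.1.ne_zero
      omega

end MonicSums

lemma map_det_aeval {K Ω n : Type*} [Field K] [Field Ω] [Algebra K Ω] [Fintype n] [DecidableEq n]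
    (M : Matrix n n K) (g : K[X]) :
    algebraMap K Ω (aeval M g).det =
      (aeval (M.map (algebraMap K Ω)) (g.map (algebraMap K Ω))).det := by
  rw [RingHom.map_det]
  congr 1
  refine map_aeval_eq_aeval_map (φ := algebraMap K Ω) (ψ := (algebraMap K Ω).mapMatrix) ?_ g M
  ext a i j
  by_cases h : i = j <;> simp [Matrix.algebraMap_matrix_apply, h]

lemma det_aeval_prod_X_sub_C {Ω n : Type*} [Field Ω] [Fintype n] [DecidableEq n]
    (M : Matrix n n Ω) (s : Multiset Ω) :
    (aeval M (s.map fun γ => X - C γ).prod).det =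
      (-1) ^ (Fintype.card n * Multiset.card s) * (s.map fun γ => M.charpoly.eval γ).prod := by
  induction s using Multiset.induction_on with
  | empty => simp
  | cons a s ih =>
    rw [Multiset.map_cons, Multiset.prod_cons, map_mul, Matrix.det_mul, ih, Multiset.map_cons,
      Multiset.prod_cons, Multiset.card_cons, Matrix.eval_charpoly]
    have : aeval M (X - C a) = -(Matrix.scalar n a - M) := by
      rw [map_sub, aeval_X, aeval_C, neg_sub]
      rfl
    rw [this, Matrix.det_neg, mul_add, mul_one, pow_add]
    ring

lemma det_aeval_charpoly {K m n : Type*} [Field K] [Fintype m] [DecidableEq m] [Fintype n]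
    [DecidableEq n] (M : Matrix m m K) (N : Matrix n n K) :
    (aeval M N.charpoly).det =
      (-1) ^ (Fintype.card m * Fintype.card n) * (aeval N M.charpoly).det := by
  apply (algebraMap K (AlgebraicClosure K)).injective
  rw [map_mul, map_det_aeval, map_det_aeval, ← Matrix.charpoly_map, ← Matrix.charpoly_map,
    map_pow, map_neg, map_one]
  generalize M.map (algebraMap K (AlgebraicClosure K)) = M'
  generalize N.map (algebraMap K (AlgebraicClosure K)) = N'
  have hM := IsAlgClosed.splits M'.charpoly
  have hN := IsAlgClosed.splits N'.charpoly
  have cM : Multiset.card M'.charpoly.roots = Fintype.card m := by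
    rw [← hM.natDegree_eq_card_roots, Matrix.charpoly_natDegree_eq_dim]
  have cN : Multiset.card N'.charpoly.roots = Fintype.card n := by
    rw [← hN.natDegree_eq_card_roots, Matrix.charpoly_natDegree_eq_dim]
  conv_lhs => rw [hN.eq_prod_roots_of_monic N'.charpoly_monic]
  conv_rhs => rw [hM.eq_prod_roots_of_monic M'.charpoly_monic]
  rw [det_aeval_prod_X_sub_C, det_aeval_prod_X_sub_C, cM, cN]
  have h1 : (N'.charpoly.roots.map fun γ => M'.charpoly.eval γ) = N'.charpoly.roots.map fun γ =>
      (M'.charpoly.roots.map fun β => γ - β).prod := by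
    refine Multiset.map_congr rfl fun γ _ => ?_
    rw [hM.eval_eq_prod_roots, M'.charpoly_monic.leadingCoeff, one_mul]
  have h2 : (M'.charpoly.roots.map fun β => N'.charpoly.eval β) = M'.charpoly.roots.map fun β =>
      ((-1) ^ Fintype.card n * (N'.charpoly.roots.map fun γ => γ - β).prod) := by
    refine Multiset.map_congr rfl fun β _ => ?_
    rw [hN.eval_eq_prod_roots, N'.charpoly_monic.leadingCoeff, one_mul, ← cN,
      ← Multiset.card_map (fun γ => γ - β) N'.charpoly.roots, ← Multiset.prod_map_neg,
      Multiset.map_map]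
    congr 1
    refine Multiset.map_congr rfl fun γ _ => ?_
    simp
  rw [h1, h2, Multiset.prod_map_mul, Multiset.map_const', Multiset.prod_replicate, cM, ← pow_mul,
    Multiset.prod_map_prod_map, mul_comm (Fintype.card n)]
  have h3 : ((-1 : AlgebraicClosure K) ^ (Fintype.card m * Fintype.card n)) *
      (-1) ^ (Fintype.card m * Fintype.card n) = 1 := by
    rw [← pow_add, Even.neg_one_pow ⟨_, rfl⟩]
  rw [← mul_assoc ((-1 : AlgebraicClosure K) ^ _) ((-1) ^ _), h3, one_mul]

lemma norm_aeval_gen {K S : Type*} [Field K] [CommRing S] [Algebra K S] (pb : PowerBasis K S)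
    (g : K[X]) : Algebra.norm K (aeval pb.gen g) =
      (aeval (Algebra.leftMulMatrix pb.basis pb.gen) g).det := by
  rw [Algebra.norm_eq_matrix_det pb.basis, aeval_algHom_apply]

lemma norm_aeval_gen_reciprocity {K S T : Type*} [Field K] [CommRing S] [Algebra K S] [CommRing T]
    [Algebra K T] (pb : PowerBasis K S) (pc : PowerBasis K T) :
    Algebra.norm K (aeval pb.gen (minpoly K pc.gen)) =
      (-1) ^ (pb.dim * pc.dim) * Algebra.norm K (aeval pc.gen (minpoly K pb.gen)) := by
  rw [norm_aeval_gen, norm_aeval_gen, ← charpoly_leftMulMatrix, ← charpoly_leftMulMatrix,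
    det_aeval_charpoly, Fintype.card_fin, Fintype.card_fin]

/-- The quadratic residue symbol of `g` modulo `f`. -/
noncomputable def residueSymbol {K : Type*} [Field K] [Fintype K] [DecidableEq K] (f : K[X]) :
    K[X] →* ℤ :=
  ((quadraticChar K).toMonoidHom.comp (Algebra.norm K)).comp
    (AdjoinRoot.mk f : K[X] →* AdjoinRoot f)

lemma residueSymbol_apply {K : Type*} [Field K] [Fintype K] [DecidableEq K] (f g : K[X]) :
    residueSymbol f g = quadraticChar K (Algebra.norm K (AdjoinRoot.mk f g)) := rfl

lemma quadraticChar_mem {K : Type*} [Field K] [Fintype K] [DecidableEq K] (a : K) :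
    quadraticChar K a ∈ ({0, 1, -1} : Set ℤ) := by
  by_cases ha : a = 0
  · simp [ha]
  · rcases quadraticChar_dichotomy ha with h | h <;> simp [h]

lemma quadraticChar_norm {K L : Type*} [Field K] [Fintype K] [DecidableEq K] [Field L] [Fintype L]
    [DecidableEq L] [Algebra K L] (h2 : ringChar K ≠ 2) (y : L) :
    quadraticChar K (Algebra.norm K y) = quadraticChar L y := by
  have h2' : ringChar L ≠ 2 := by rwa [← Algebra.ringChar_eq K L]
  refine Int.cast_injOn_of_ringChar_ne_two h2' (quadraticChar_mem _)
    (quadraticChar_mem _) ?_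
  rw [quadraticChar_eq_pow_of_char_ne_two' h2', ← map_intCast (algebraMap K L),
    quadraticChar_eq_pow_of_char_ne_two' h2, map_pow, FiniteField.algebraMap_norm_eq_pow, ← pow_mul]
  congr 1
  have hK := FiniteField.odd_card_of_char_ne_two h2
  have hL := FiniteField.odd_card_of_char_ne_two h2'
  have hK1 : 1 < Fintype.card K := Fintype.one_lt_card
  have hKL : Fintype.card K - 1 ∣ Fintype.card L - 1 := by
    have h := Module.card_eq_pow_finrank (K := K) (V := L)
    rw [h]
    exact Nat.sub_one_dvd_pow_sub_one _ _
  rw [Nat.card_eq_fintype_card, Nat.card_eq_fintype_card]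
  obtain ⟨a, ha⟩ : ∃ a, Fintype.card K = 2 * a + 1 := ⟨Fintype.card K / 2, by omega⟩
  obtain ⟨b, hb⟩ : ∃ b, Fintype.card L = 2 * b + 1 := ⟨Fintype.card L / 2, by omega⟩
  obtain ⟨c, hc⟩ := hKL
  rw [hc, Nat.mul_div_cancel_left _ (by omega)]
  rw [ha, hb] at *
  have : 2 * b = 2 * a * c := by simpa using hc
  have h5 : (2 * a + 1) / 2 = a := by omega
  have h6 : (2 * b + 1) / 2 = b := by omega
  rw [h5, h6]
  nlinarith

lemma quadraticChar_aeval {K L : Type*} [Field K] [Fintype K] [DecidableEq K] [Field L] [Fintype L]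
    [DecidableEq L] [Algebra K L] (h2 : ringChar K ≠ 2) {f : K[X]} (hf : f.Monic)
    (hr : Even (Module.finrank K L)) (x : L) :
    quadraticChar L (aeval x f) =
      residueSymbol f (minpoly K x) ^ (Module.finrank K L / (minpoly K x).natDegree) := by
  have hx : IsIntegral K x := Algebra.IsIntegral.isIntegral x
  let pc := IntermediateField.adjoin.powerBasis hx
  let pb := AdjoinRoot.powerBasis hf.ne_zero
  have hpc : pc.gen = IntermediateField.AdjoinSimple.gen K x :=
    IntermediateField.adjoin.powerBasis_gen hx
  have hmc : minpoly K pc.gen = minpoly K x := by rw [hpc, IntermediateField.minpoly_gen]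
  have hmb : minpoly K pb.gen = f := by
    rw [AdjoinRoot.powerBasis_gen, AdjoinRoot.minpoly_root hf.ne_zero, hf.leadingCoeff]
    simp
  have hdim : pc.dim = (minpoly K x).natDegree := by rw [← hmc, pc.natDegree_minpoly]
  have hfin : Module.finrank K L =
      (minpoly K x).natDegree * Module.finrank (IntermediateField.adjoin K {x}) L := by
    rw [← IntermediateField.adjoin.finrank hx, Module.finrank_mul_finrank]
  have hpos : 0 < (minpoly K x).natDegree := minpoly.natDegree_pos hx
  have hdiv : Module.finrank K L / (minpoly K x).natDegree =
      Module.finrank (IntermediateField.adjoin K {x}) L := by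
    rw [hfin, Nat.mul_div_cancel_left _ hpos]
  have hy : aeval x f = algebraMap (IntermediateField.adjoin K {x}) L (aeval pc.gen f) := by
    rw [hpc, ← aeval_algebraMap_apply, IntermediateField.AdjoinSimple.algebraMap_gen]
  have hrec := norm_aeval_gen_reciprocity pc pb
  rw [hmb, hmc, AdjoinRoot.powerBasis_gen, AdjoinRoot.aeval_eq] at hrec
  rw [← quadraticChar_norm h2, hy, ← Algebra.norm_norm (S := IntermediateField.adjoin K {x}),
    Algebra.norm_algebraMap, map_pow, hrec, hdiv, mul_pow, ← pow_mul, map_mul, map_pow,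
    residueSymbol_apply, map_pow]
  have hev : Even (pc.dim * pb.dim * Module.finrank (IntermediateField.adjoin K {x}) L) := by
    rw [hdim, mul_right_comm, ← hfin]
    exact hr.mul_right _
  obtain ⟨c, hc⟩ := hev
  rw [hc, ← map_pow, ← two_mul, pow_mul]
  simp

lemma card_filter_minpoly_eq {K L : Type*} [Field K] [Fintype K] [Field L] [Fintype L]
    [DecidableEq K[X]] [Algebra K L] {P : K[X]} (hP : P.Monic) (hi : Irreducible P) :
    (Finset.univ.filter fun x : L => minpoly K x = P).card =
      if P.natDegree ∣ Module.finrank K L then P.natDegree else 0 := by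
  classical
  split_ifs with hd
  · have : Fact (Irreducible P) := ⟨hi⟩
    have hfr : Module.finrank K (AdjoinRoot P) = P.natDegree := by
      rw [(AdjoinRoot.powerBasis hi.ne_zero).finrank, AdjoinRoot.powerBasis_dim]
    obtain ⟨σ⟩ := FiniteField.nonempty_algHom_of_finrank_dvd (F := K) (K := AdjoinRoot P) (L := L)
      (by rwa [hfr])
    have hroot : aeval (σ (AdjoinRoot.root P)) P = 0 := by
      rw [aeval_algHom_apply, AdjoinRoot.aeval_eq, AdjoinRoot.mk_self, map_zero]
    have hmin := minpoly.eq_of_irreducible_of_monic hi hroot hP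
    have hsplit : (P.map (algebraMap K L)).Splits := by
      rw [hmin]
      exact Normal.splits inferInstance _
    have hsep : P.Separable := PerfectField.separable_of_irreducible hi
    rw [← card_rootSet_eq_natDegree hsep hsplit, ← Set.toFinset_card]
    congr 1
    ext x
    rw [Finset.mem_filter, Set.mem_toFinset, mem_rootSet_of_ne hi.ne_zero]
    refine ⟨fun h => by rw [← h.2]; exact minpoly.aeval K x, fun h => ⟨Finset.mem_univ _, ?_⟩⟩
    exact (minpoly.eq_of_irreducible_of_monic hi h hP).symm
  · rw [Finset.card_eq_zero, Finset.filter_eq_empty_iff]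
    rintro x - rfl
    exact hd (minpoly.degree_dvd (Algebra.IsIntegral.isIntegral x))

lemma sum_quadraticChar_aeval {K L : Type*} [Field K] [Fintype K] [DecidableEq K] [Field L]
    [Fintype L] [DecidableEq L] [Algebra K L] (h2 : ringChar K ≠ 2) {f : K[X]} (hf : f.Monic)
    (hr : Even (Module.finrank K L)) :
    ∑ x : L, quadraticChar L (aeval x f) =
      primePowerSum (residueSymbol f) (Module.finrank K L) := by
  classical
  have hmaps : ∀ x ∈ (Finset.univ : Finset L),
      minpoly K x ∈ monicIrreducibles K (Module.finrank K L) := by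
    intro x _
    have hx : IsIntegral K x := Algebra.IsIntegral.isIntegral x
    rw [mem_monicIrreducibles]
    exact ⟨minpoly.monic hx, minpoly.irreducible hx,
      Nat.le_of_dvd Module.finrank_pos (minpoly.degree_dvd hx)⟩
  rw [primePowerSum, ← Finset.sum_fiberwise_of_maps_to hmaps]
  refine Finset.sum_congr rfl fun P hP => ?_
  rw [mem_monicIrreducibles] at hP
  have h1 : ∀ x ∈ Finset.univ.filter (fun x : L => minpoly K x = P),
      quadraticChar L (aeval x f) =
        residueSymbol f P ^ (Module.finrank K L / P.natDegree) := by
    intro x hx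
    rw [Finset.mem_filter] at hx
    rw [quadraticChar_aeval h2 hf hr, hx.2]
  rw [Finset.sum_congr rfl h1, Finset.sum_const, card_filter_minpoly_eq hP.1 hP.2.1, nsmul_eq_mul]
  split_ifs <;> simp

lemma sum_monics_add {K : Type*} [Field K] [Finite K] {M : Type*} [AddCommMonoid M] (φ : K[X] → M)
    {m : ℕ} {ρ : K[X]} (hρ : ρ.degree < m) :
    ∑ g ∈ monics K m, φ (g + ρ) = ∑ g ∈ monics K m, φ g := by
  have key : ∀ σ : K[X], σ.degree < m → ∀ g ∈ monics K m, g + σ ∈ monics K m := by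
    intro σ hσ g hg
    rw [mem_monics] at hg ⊢
    have hdeg : σ.degree < g.degree := by rwa [degree_eq_natDegree hg.1.ne_zero, hg.2]
    exact ⟨hg.1.add_of_left hdeg, by rw [natDegree_add_eq_left_of_degree_lt hdeg, hg.2]⟩
  refine Finset.sum_bij (fun g _ => g + ρ) (key ρ hρ) (fun a _ b _ h => add_right_cancel h)
    (fun g hg => ⟨g + -ρ, key (-ρ) (by rwa [degree_neg]) g hg, by ring⟩) (fun _ _ => rfl)

lemma monicSum_residueSymbol_eq_zero {K : Type*} [Field K] [Fintype K] [DecidableEq K] {f : K[X]}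
    (hf : f.Monic) {g₀ : K[X]} (hg₀ : residueSymbol f g₀ = -1) {m : ℕ} (hm : f.natDegree ≤ m) :
    monicSum (residueSymbol f) m = 0 := by
  classical
  have hfin : Module.Finite K (AdjoinRoot f) := hf.finite_adjoinRoot
  have : Finite (AdjoinRoot f) := Module.finite_of_finite K
  have := Fintype.ofFinite (AdjoinRoot f)
  have hunit : IsUnit (AdjoinRoot.mk f g₀) := by
    rw [residueSymbol_apply] at hg₀
    have h0 : Algebra.norm K (AdjoinRoot.mk f g₀) ≠ 0 := fun h => by simp [h] at hg₀
    have h1 : IsUnit (Algebra.lmul K (AdjoinRoot f) (AdjoinRoot.mk f g₀)) := by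
      rw [LinearMap.isUnit_iff_isUnit_det, ← Algebra.norm_apply]
      exact h0.isUnit
    have h2 := ((Module.End.isUnit_iff _).mp h1).2 1
    obtain ⟨b, hb⟩ := h2
    exact IsUnit.of_mul_eq_one b hb
  have hzero : ∑ a : AdjoinRoot f, quadraticChar K (Algebra.norm K a) = 0 := by
    have h1 : ∑ a : AdjoinRoot f, quadraticChar K (Algebra.norm K (AdjoinRoot.mk f g₀ * a)) =
        ∑ a : AdjoinRoot f, quadraticChar K (Algebra.norm K a) :=
      Fintype.sum_equiv (Units.mulLeft hunit.unit) _ _ fun a => rfl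
    simp only [map_mul] at h1
    rw [← residueSymbol_apply, hg₀, ← Finset.mul_sum] at h1
    linarith
  have hshift : ∀ a : AdjoinRoot f, ∑ g ∈ monics K m,
      quadraticChar K (Algebra.norm K (AdjoinRoot.mk f g + a)) =
        monicSum (residueSymbol f) m := by
    intro a
    have hdeg : (AdjoinRoot.modByMonicHom hf a).degree < m := by
      induction a using AdjoinRoot.induction_on with
      | ih a =>
        rw [AdjoinRoot.modByMonicHom_mk]
        refine (degree_modByMonic_lt a hf).trans_le ?_
        rw [degree_eq_natDegree hf.ne_zero]
        exact_mod_cast hm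
    have h1 := sum_monics_add (residueSymbol f) hdeg
    rw [monicSum, ← h1]
    refine Finset.sum_congr rfl fun g _ => ?_
    rw [residueSymbol_apply, map_add (AdjoinRoot.mk f), AdjoinRoot.mk_leftInverse hf]
  have htotal : ∑ _a : AdjoinRoot f, monicSum (residueSymbol f) m = 0 := by
    rw [← Finset.sum_congr rfl fun a _ => hshift a, Finset.sum_comm]
    refine Finset.sum_eq_zero fun g _ => ?_
    rw [← hzero]
    exact Fintype.sum_equiv (Equiv.addLeft (AdjoinRoot.mk f g)) _ _ fun a => rfl
  rw [Finset.sum_const, nsmul_eq_mul, mul_eq_zero] at htotal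
  refine htotal.resolve_left ?_
  exact_mod_cast Fintype.card_ne_zero

lemma monicSum_residueSymbol_one {K : Type*} [Field K] [Fintype K] [DecidableEq K] {f : K[X]}
    (hf : f.Monic) : |monicSum (residueSymbol f) 1| = |∑ x : K, quadraticChar K (f.eval x)| := by
  classical
  have h1 : monics K 1 = Finset.univ.image fun a : K => X - C a := by
    ext g
    rw [mem_monics, Finset.mem_image]
    constructor
    · rintro ⟨hm, hd⟩
      refine ⟨-g.coeff 0, Finset.mem_univ _, ?_⟩
      rw [hm.eq_X_add_C hd]
      simp
    · rintro ⟨a, -, rfl⟩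
      exact ⟨monic_X_sub_C a, natDegree_X_sub_C a⟩
  have h2 : ∀ a : K, residueSymbol f (X - C a) =
      quadraticChar K ((-1) ^ f.natDegree) * quadraticChar K (f.eval a) := by
    intro a
    have hgen := norm_aeval_gen (AdjoinRoot.powerBasis hf.ne_zero) (X - C a)
    have hdet := det_aeval_prod_X_sub_C (Algebra.leftMulMatrix
      (AdjoinRoot.powerBasis hf.ne_zero).basis (AdjoinRoot.powerBasis hf.ne_zero).gen) {a}
    rw [charpoly_leftMulMatrix] at hdet
    rw [Multiset.map_singleton, Multiset.prod_singleton] at hdet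
    rw [hdet, AdjoinRoot.powerBasis_gen, AdjoinRoot.aeval_eq] at hgen
    rw [residueSymbol_apply, hgen, AdjoinRoot.minpoly_root hf.ne_zero, hf.leadingCoeff, map_mul]
    simp
  rw [monicSum, h1, Finset.sum_image fun a _ b _ h => by simpa using h,
    Finset.sum_congr rfl fun a _ => h2 a, ← Finset.mul_sum, abs_mul]
  have h3 : |quadraticChar K ((-1) ^ f.natDegree)| = 1 := by
    rcases quadraticChar_dichotomy (F := K) (a := (-1) ^ f.natDegree) (by simp) with h | h <;>
      rw [h] <;> rfl
  rw [h3, one_mul]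

lemma map_ne_C_mul_sq {K L : Type*} [Field K] [Field L] [Algebra K L] [Algebra.IsAlgebraic K L]
    {f : K[X]} (hf : ∀ (c : AlgebraicClosure K) (h : (AlgebraicClosure K)[X]),
      f.map (algebraMap K (AlgebraicClosure K)) ≠ C c * h ^ 2) (c : L) (h : L[X]) :
    f.map (algebraMap K L) ≠ C c * h ^ 2 := by
  intro heq
  let σ : L →ₐ[K] AlgebraicClosure K := IsAlgClosed.lift
  refine hf (σ c) (h.map (σ : L →+* AlgebraicClosure K)) ?_
  have := congrArg (Polynomial.map (σ : L →+* AlgebraicClosure K)) heq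
  rw [Polynomial.map_map, AlgHom.comp_algebraMap] at this
  simpa using this

lemma exists_extension {K : Type*} [Field K] [Fintype K] [DecidableEq K] (h2 : ringChar K ≠ 2)
    {f : K[X]} (hf : ∀ (c : AlgebraicClosure K) (h : (AlgebraicClosure K)[X]),
      f.map (algebraMap K (AlgebraicClosure K)) ≠ C c * h ^ 2) {s : ℕ} (hs : s ≠ 0)
    (hd : 4 * f.natDegree + 13 ≤ Fintype.card K ^ s) :
    ∃ (L : Type) (_ : Field L) (_ : Fintype L) (_ : DecidableEq L) (_ : Algebra K L),
      Module.finrank K L = 2 * s ∧ Fintype.card L = (Fintype.card K ^ s) ^ 2 ∧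
      |∑ x : L, quadraticChar L (aeval x f)| ≤
        (4 * f.natDegree + 7) * (Fintype.card K ^ s : ℤ) := by
  classical
  obtain ⟨p, hp⟩ := CharP.exists K
  obtain ⟨k, hpp, hk⟩ := FiniteField.card K p
  have : Fact p.Prime := ⟨hpp⟩
  have : NeZero (2 * s) := ⟨by omega⟩
  let L := FiniteField.Extension K p (2 * s)
  have : Finite L := Module.finite_of_finite K
  let _ : Fintype L := Fintype.ofFinite L
  have : CharP L p := charP_of_injective_algebraMap (algebraMap K L).injective p
  have hcard : Fintype.card L = (Fintype.card K ^ s) ^ 2 := by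
    rw [← Nat.card_eq_fintype_card, FiniteField.natCard_extension, Nat.card_eq_fintype_card,
      ← pow_mul, mul_comm]
  refine ⟨L, inferInstance, inferInstance, inferInstance, inferInstance,
    FiniteField.finrank_extension K p (2 * s), hcard, ?_⟩
  have hpow : p ^ (k * s : ℕ) = Fintype.card K ^ s := by rw [hk, pow_mul]
  have h3 := abs_sum_quadraticChar_le_of_card_eq_sq (K := L) (p := p) (k * s : ℕ)
    (by rw [hcard, hpow]) (by rwa [← Algebra.ringChar_eq K L])
    (f := f.map (algebraMap K L)) (map_ne_C_mul_sq hf) (by rw [natDegree_map, hpow]; exact hd)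
  rw [natDegree_map] at h3
  have hpow' : (p : ℤ) ^ (k * s : ℕ) = (Fintype.card K : ℤ) ^ s := by exact_mod_cast hpow
  rw [hpow'] at h3
  simpa only [eval_map_algebraMap] using h3

lemma abs_primePowerSum_residueSymbol_le {K : Type*} [Field K] [Fintype K] [DecidableEq K]
    (h2 : ringChar K ≠ 2) {f : K[X]} (hm : f.Monic)
    (hf : ∀ (c : AlgebraicClosure K) (h : (AlgebraicClosure K)[X]),
      f.map (algebraMap K (AlgebraicClosure K)) ≠ C c * h ^ 2) {s : ℕ} (hs : s ≠ 0)
    (hd : 4 * f.natDegree + 13 ≤ Fintype.card K ^ s) :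
    |primePowerSum (residueSymbol f) (2 * s)| ≤
      (4 * f.natDegree + 7) * (Fintype.card K ^ s : ℤ) := by
  obtain ⟨L, _, _, _, _, hr, -, hle⟩ := exists_extension h2 hf hs hd
  rwa [sum_quadraticChar_aeval h2 hm (by rw [hr]; exact even_two_mul s), hr] at hle

lemma exists_residueSymbol_eq_neg_one {K : Type*} [Field K] [Fintype K] [DecidableEq K]
    (h2 : ringChar K ≠ 2) {f : K[X]} (hm : f.Monic)
    (hf : ∀ (c : AlgebraicClosure K) (h : (AlgebraicClosure K)[X]),
      f.map (algebraMap K (AlgebraicClosure K)) ≠ C c * h ^ 2) :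
    ∃ g, residueSymbol f g = -1 := by
  by_contra! hno
  obtain ⟨s, hs⟩ := pow_unbounded_of_one_lt (4 * f.natDegree + 13)
    (Fintype.one_lt_card (α := K))
  have hs0 : s ≠ 0 := by rintro rfl; simp at hs
  obtain ⟨L, _, _, _, _, hr, hcard, hle⟩ := exists_extension h2 hf hs0 hs.le
  have hχ : ∀ x : L, quadraticChar L (aeval x f) = 1 - (if aeval x f = 0 then 1 else 0) := by
    intro x
    split_ifs with h0
    · simp [h0]
    · have h1 := quadraticChar_aeval h2 hm (by rw [hr]; exact even_two_mul s) x
      rcases quadraticChar_dichotomy h0 with h | h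
      · simp [h]
      · rw [h] at h1
        refine absurd ?_ (hno (minpoly K x ^ (Module.finrank K L / (minpoly K x).natDegree)))
        rw [map_pow, h1]
  rw [Finset.sum_congr rfl fun x _ => hχ x, Finset.sum_sub_distrib] at hle
  have hZ := card_filter_eval_eq_zero_le (f := f.map (algebraMap K L))
    (by rw [Polynomial.map_ne_zero_iff (algebraMap K L).injective]; exact hm.ne_zero)
  rw [natDegree_map] at hZ
  simp only [eval_map_algebraMap] at hZ
  have h3 := (abs_le.mp hle).2
  simp only [Finset.sum_const, Finset.card_univ, Finset.sum_boole, hcard, nsmul_eq_mul,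
    mul_one] at h3
  push_cast at h3
  have hs' : (4 * f.natDegree + 13 : ℤ) < (Fintype.card K : ℤ) ^ s := by exact_mod_cast hs
  have hZ' : ((Finset.univ.filter fun x : L => aeval x f = 0).card : ℤ) ≤ f.natDegree := by
    exact_mod_cast hZ
  nlinarith

lemma norm_le_of_norm_sum_pow_le {ι : Type*} [Fintype ι] (l : ι → ℂ) {A ρ : ℝ} (hρ : 0 < ρ)
    (hle : ∀ s : ℕ, s ≠ 0 → ‖∑ i, l i ^ s‖ ≤ A * ρ ^ s) (i : ι) : ‖l i‖ ≤ ρ := by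
  classical
  set h : ℂ[X] := ∏ μ ∈ (Finset.univ.image l).erase (l i), (X - C μ) with hh
  have hi : h.eval (l i) ≠ 0 := by
    rw [hh, eval_prod, Finset.prod_ne_zero_iff]
    intro μ hμ
    rw [Finset.mem_erase] at hμ
    simpa [sub_eq_zero] using hμ.1.symm
  have hj : ∀ j, l j ≠ l i → h.eval (l j) = 0 := by
    intro j hji
    rw [hh, eval_prod]
    refine Finset.prod_eq_zero (i := l j) ?_ (by simp)
    rw [Finset.mem_erase]
    exact ⟨hji, Finset.mem_image_of_mem _ (Finset.mem_univ j)⟩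
  set n := (Finset.univ.filter fun j => l j = l i).card with hn
  have hn0 : n ≠ 0 := Finset.card_ne_zero.mpr ⟨i, by simp⟩
  have key : ∀ s, (n : ℂ) * h.eval (l i) * l i ^ s =
      ∑ k ∈ Finset.range (h.natDegree + 1), h.coeff k * ∑ j, l j ^ (k + s) := by
    intro s
    have h1 : ∑ j, h.eval (l j) * l j ^ s = (n : ℂ) * h.eval (l i) * l i ^ s := by
      rw [← Finset.sum_filter_add_sum_filter_not Finset.univ (fun j => l j = l i),
        Finset.sum_congr rfl (g := fun _ => h.eval (l i) * l i ^ s), Finset.sum_const, nsmul_eq_mul,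
        Finset.sum_eq_zero, add_zero, mul_assoc]
      · intro j hjm
        rw [hj j (by simpa using hjm), zero_mul]
      · intro j hjm
        rw [(by simpa using hjm : l j = l i)]
    rw [← h1]
    simp only [Finset.mul_sum]
    rw [Finset.sum_comm]
    refine Finset.sum_congr rfl fun j _ => ?_
    rw [eval_eq_sum_range, Finset.sum_mul]
    exact Finset.sum_congr rfl fun k _ => by rw [pow_add, mul_assoc]
  set B := ∑ k ∈ Finset.range (h.natDegree + 1), ‖h.coeff k‖ * (A * ρ ^ k) with hB
  have hbound : ∀ s : ℕ, s ≠ 0 → ‖(n : ℂ) * h.eval (l i)‖ * ‖l i‖ ^ s ≤ B * ρ ^ s := by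
    intro s hs
    rw [← norm_pow, ← norm_mul, key, hB, Finset.sum_mul]
    refine (norm_sum_le _ _).trans (Finset.sum_le_sum fun k _ => ?_)
    rw [norm_mul, mul_assoc, mul_assoc, ← pow_add]
    exact mul_le_mul_of_nonneg_left (hle _ (by omega)) (norm_nonneg _)
  by_contra! hlt
  have hpos : 0 < ‖(n : ℂ) * h.eval (l i)‖ :=
    norm_pos_iff.mpr (mul_ne_zero (by exact_mod_cast hn0) hi)
  obtain ⟨s, hs⟩ := pow_unbounded_of_one_lt (max 1 (B / ‖(n : ℂ) * h.eval (l i)‖))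
    ((one_lt_div hρ).mpr hlt)
  have hs0 : s ≠ 0 := by
    rintro rfl
    rw [pow_zero] at hs
    exact absurd (le_max_left _ _) (not_le.mpr hs)
  have h2 := (le_max_right _ _).trans_lt hs
  rw [div_pow, div_lt_div_iff₀ hpos (pow_pos hρ s)] at h2
  have := hbound s hs0
  linarith

lemma exists_newton_roots {c : ℕ → ℂ} (h0 : c 0 = 1) {D : ℕ} (hc : ∀ m, D < m → c m = 0) :
    ∃ ω : Fin D → ℂ, ∀ m : ℕ, m * c m =
      -∑ a ∈ Finset.HasAntidiagonal.antidiagonal m with a.1 < m, c a.1 * ∑ i, ω i ^ a.2 := by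
  set Q : ℂ[X] := ∑ m ∈ Finset.range (D + 1), C (c m) * X ^ (D - m) with hQ
  have hcoeff : ∀ m ≤ D, Q.coeff (D - m) = c m := by
    intro m hm
    rw [hQ, finsetSum_coeff, Finset.sum_eq_single_of_mem m (by rw [Finset.mem_range]; omega)]
    · simp
    · intro k hk hkm
      rw [Finset.mem_range] at hk
      rw [coeff_C_mul, coeff_X_pow, if_neg (by omega), mul_zero]
  have hdegle : Q.natDegree ≤ D := by
    rw [hQ]
    refine natDegree_sum_le_of_forall_le _ _ fun m _ => ?_
    exact (natDegree_C_mul_X_pow_le _ _).trans (by omega)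
  have hmonic : Q.Monic := monic_of_natDegree_le_of_coeff_eq_one D hdegle (by
    have := hcoeff 0 (by omega)
    rwa [Nat.sub_zero, h0] at this)
  have hdeg : Q.natDegree = D := by
    refine le_antisymm hdegle (le_natDegree_of_ne_zero ?_)
    have := hcoeff 0 (by omega)
    rw [Nat.sub_zero, h0] at this
    rw [this]
    exact one_ne_zero
  have hsplit := IsAlgClosed.splits Q
  have hcard : Multiset.card Q.roots = D := by rw [← hsplit.natDegree_eq_card_roots, hdeg]
  obtain ⟨ω, hω⟩ : ∃ ω : Fin D → ℂ, (Finset.univ.val.map ω) = Q.roots := by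
    have hlen : Q.roots.toList.length = D := by rw [Multiset.length_toList, hcard]
    refine ⟨fun i => Q.roots.toList.get (i.cast hlen.symm), ?_⟩
    rw [Fin.univ_val_map]
    conv_rhs => rw [← Multiset.coe_toList Q.roots]
    congr 1
    refine List.ext_get (by simp [hlen]) fun k h1 h2 => by simp
  have hesymm : ∀ m, c m = (-1) ^ m * MvPolynomial.aeval ω (MvPolynomial.esymm (Fin D) ℂ m) := by
    intro m
    rw [MvPolynomial.aeval_esymm_eq_multiset_esymm, hω]
    by_cases hm : m ≤ D
    · rw [← hcoeff m hm, coeff_eq_esymm_roots_of_card (by rw [hcard, hdeg]) (by rw [hdeg]; omega),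
        hmonic.leadingCoeff, hdeg, one_mul, Nat.sub_sub_self hm]
    · rw [hc m (by omega), Multiset.esymm, Multiset.powersetCard_eq_empty m (by rw [hcard]; omega)]
      simp
  refine ⟨ω, fun m => ?_⟩
  have hN := congrArg (MvPolynomial.aeval ω) (MvPolynomial.mul_esymm_eq_sum (Fin D) ℂ m)
  simp only [map_mul, map_natCast, map_sum, map_pow, map_neg, map_one, MvPolynomial.psum,
    MvPolynomial.aeval_X] at hN
  rw [hesymm m, mul_left_comm, hN, ← mul_assoc, ← pow_add, Odd.neg_one_pow ⟨m, by ring⟩, neg_one_mul]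
  congr 1
  exact Finset.sum_congr rfl fun a _ => by rw [hesymm a.1]

lemma abs_le_of_recurrence {c S : ℕ → ℤ} (h0 : c 0 = 1)
    (hrec : ∀ m : ℕ, m * c m = ∑ r ∈ Finset.Icc 1 m, S r * c (m - r)) {D : ℕ}
    (hc : ∀ m, D < m → c m = 0) {A ρ : ℝ} (hρ : 0 < ρ)
    (hS : ∀ s : ℕ, s ≠ 0 → |(S (2 * s) : ℝ)| ≤ A * ρ ^ s) : |(c 1 : ℝ)| ≤ D * √ρ := by
  obtain ⟨ω, hω⟩ := exists_newton_roots (c := fun m => (c m : ℂ)) (D := D) (by simp [h0])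
    (fun m hm => by simp [hc m hm])
  have hSω : ∀ m : ℕ, m ≠ 0 → (S m : ℂ) = -∑ i, ω i ^ m := by
    intro m
    induction m using Nat.strong_induction_on with
    | _ m ih =>
    intro hm
    have h1 : (m : ℂ) * c m = ∑ r ∈ Finset.Icc 1 m, (S r : ℂ) * c (m - r) := by
      exact_mod_cast hrec m
    have h2 : ∑ a ∈ Finset.HasAntidiagonal.antidiagonal m with a.1 < m, (c a.1 : ℂ) * ∑ i, ω i ^ a.2 =
        ∑ r ∈ Finset.Icc 1 m, (c (m - r) : ℂ) * ∑ i, ω i ^ r := by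
      symm
      refine Finset.sum_bij (fun r _ => (m - r, r)) ?_ ?_ ?_ ?_
      · intro r hr
        rw [Finset.mem_Icc] at hr
        simp only [Finset.mem_filter, Finset.HasAntidiagonal.mem_antidiagonal]
        omega
      · intro a _ b _ h
        exact (Prod.mk.injEq _ _ _ _ ▸ h).2
      · rintro ⟨a, b⟩ hab
        simp only [Finset.mem_filter, Finset.HasAntidiagonal.mem_antidiagonal] at hab
        refine ⟨b, by rw [Finset.mem_Icc]; omega, ?_⟩
        rw [Prod.mk.injEq]
        omega
      · intro r _
        rfl
    have h3 := hω m
    rw [h1, h2] at h3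
    have hIcc : Finset.Icc 1 m = insert m (Finset.Icc 1 (m - 1)) := by
      ext r
      simp only [Finset.mem_insert, Finset.mem_Icc]
      omega
    have hnot : m ∉ Finset.Icc 1 (m - 1) := by
      rw [Finset.mem_Icc]
      omega
    rw [hIcc, Finset.sum_insert hnot, Finset.sum_insert hnot, Nat.sub_self, h0] at h3
    have h4 : ∑ r ∈ Finset.Icc 1 (m - 1), (S r : ℂ) * c (m - r) =
        -∑ r ∈ Finset.Icc 1 (m - 1), (c (m - r) : ℂ) * ∑ i, ω i ^ r := by
      rw [← Finset.sum_neg_distrib]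
      refine Finset.sum_congr rfl fun r hr => ?_
      rw [Finset.mem_Icc] at hr
      rw [ih r (by omega) (by omega)]
      ring
    rw [h4] at h3
    push_cast at h3
    linear_combination h3
  have hω2 : ∀ i, ‖ω i‖ ≤ √ρ := by
    intro i
    have h1 := norm_le_of_norm_sum_pow_le (fun i => ω i ^ 2) hρ (A := A) (by
      intro s hs
      have h2 := hS s hs
      have h3 : ∑ i, (ω i ^ 2) ^ s = -(S (2 * s) : ℂ) := by
        rw [hSω _ (by omega), neg_neg]
        exact Finset.sum_congr rfl fun i _ => by rw [pow_mul]
      rw [h3, norm_neg, Complex.norm_intCast]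
      exact h2) i
    rw [norm_pow] at h1
    exact Real.le_sqrt_of_sq_le h1
  have hc1 : c 1 = S 1 := by simpa [h0] using hrec 1
  have h5 := hSω 1 one_ne_zero
  have h6 : |(c 1 : ℝ)| = ‖∑ i, ω i‖ := by
    rw [hc1, ← Complex.norm_intCast, h5, norm_neg]
    simp
  rw [h6]
  refine (norm_sum_le _ _).trans ((Finset.sum_le_sum fun i _ => hω2 i).trans ?_)
  simp

/-- The Weil bound for quadratic character sums. -/
lemma abs_sum_quadraticChar_eval_le {K : Type*} [Field K] [Fintype K] [DecidableEq K]
    (h2 : ringChar K ≠ 2) {f : K[X]}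
    (hf : ∀ (c : AlgebraicClosure K) (h : (AlgebraicClosure K)[X]),
      f.map (algebraMap K (AlgebraicClosure K)) ≠ C c * h ^ 2) :
    |((∑ x : K, quadraticChar K (f.eval x) : ℤ) : ℝ)| ≤
      ((f.natDegree - 1 : ℕ) : ℝ) * √(Fintype.card K) := by
  wlog hm : f.Monic generalizing f
  · have hf0 : f ≠ 0 := by
      rintro rfl
      exact hf 0 0 (by simp)
    have hlc : f.leadingCoeff ≠ 0 := leadingCoeff_ne_zero.mpr hf0
    have h1 := this (f := C f.leadingCoeff⁻¹ * f) (by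
      intro c h heq
      rw [Polynomial.map_mul, map_C] at heq
      refine hf (algebraMap K _ f.leadingCoeff * c) h ?_
      rw [C_mul, mul_assoc, ← heq, ← mul_assoc, ← C_mul, ← map_mul, mul_inv_cancel₀ hlc]
      simp) (monic_C_mul_of_mul_leadingCoeff_eq_one (inv_mul_cancel₀ hlc))
    rw [natDegree_C_mul (inv_ne_zero hlc)] at h1
    refine le_trans (le_of_eq ?_) h1
    simp only [eval_mul, eval_C, map_mul, ← Finset.mul_sum]
    rcases quadraticChar_dichotomy (inv_ne_zero hlc) with h | h <;> rw [h] <;> simp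
  · have hd : f.natDegree ≠ 0 := by
      have := natDegree_ne_zero_of_not_const_mul_sq hf
      rwa [natDegree_map] at this
    obtain ⟨g₀, hg₀⟩ := exists_residueSymbol_eq_neg_one h2 hm hf
    have hq : (1 : ℝ) < Fintype.card K := by exact_mod_cast Fintype.one_lt_card (α := K)
    have hq0 : (0 : ℝ) < Fintype.card K := by linarith
    obtain ⟨s₀, hs₀⟩ := pow_unbounded_of_one_lt (4 * f.natDegree + 13)
      (Fintype.one_lt_card (α := K))
    set S := primePowerSum (residueSymbol f)
    have h1 := abs_le_of_recurrence (c := monicSum (residueSymbol f)) (S := S)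
      (monicSum_zero _) (natCast_mul_monicSum _) (D := f.natDegree - 1)
      (fun m hm' => monicSum_residueSymbol_eq_zero hm hg₀ (by omega)) hq0
      (A := (4 * f.natDegree + 7) + ∑ s ∈ Finset.range s₀, |(S (2 * s) : ℝ)|) (by
        intro s hs
        have hpow : (1 : ℝ) ≤ (Fintype.card K : ℝ) ^ s := one_le_pow₀ hq.le
        have hnn : 0 ≤ ∑ s ∈ Finset.range s₀, |(S (2 * s) : ℝ)| :=
          Finset.sum_nonneg fun _ _ => abs_nonneg _
        by_cases hss : s < s₀
        · have h3 := Finset.single_le_sum (f := fun s => |(S (2 * s) : ℝ)|)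
            (fun _ _ => abs_nonneg _) (Finset.mem_range.mpr hss)
          have h4 : (0 : ℝ) ≤ 4 * f.natDegree + 7 := by positivity
          nlinarith
        · have h3 := abs_primePowerSum_residueSymbol_le h2 hm hf hs
            (hs₀.le.trans (Nat.pow_le_pow_right Fintype.card_pos (not_lt.mp hss)))
          have h4 : |(S (2 * s) : ℝ)| ≤ (4 * f.natDegree + 7) * (Fintype.card K : ℝ) ^ s := by
            exact_mod_cast h3
          nlinarith)
    have h3 : |(monicSum (residueSymbol f) 1 : ℝ)| =
        |((∑ x : K, quadraticChar K (f.eval x) : ℤ) : ℝ)| := by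
      exact_mod_cast monicSum_residueSymbol_one hm
    rwa [h3] at h1

/-- The discriminant of the monic cubic `x³ + p x² + r x + s`. -/
def cubicDisc {R : Type*} [CommRing R] (p r s : R) : R :=
  p ^ 2 * r ^ 2 - 4 * r ^ 3 - 4 * p ^ 3 * s + 18 * p * r * s - 27 * s ^ 2

lemma cubicDisc_eq_zero_of_double_root {R : Type*} [CommRing R] {p r s x : R}
    (h : x ^ 3 + p * x ^ 2 + r * x + s = 0) (h' : 3 * x ^ 2 + 2 * p * x + r = 0) :
    cubicDisc p r s = 0 := by
  have hr : r = -(3 * x ^ 2 + 2 * p * x) := by linear_combination h'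
  have hs : s = -(x ^ 3 + p * x ^ 2 + r * x) := by linear_combination h
  rw [cubicDisc, hs, hr]
  ring

lemma exists_double_root {K : Type*} [Field K] (h2 : (2 : K) ≠ 0) {p r s p' r' s' : K}
    (hD : cubicDisc p r s = 0)
    (hD' : (2 * p * r ^ 2 - 12 * p ^ 2 * s + 18 * r * s) * p' +
      (2 * p ^ 2 * r - 12 * r ^ 2 + 18 * p * s) * r' +
      (-4 * p ^ 3 + 18 * p * r - 54 * s) * s' = 0) (hH : p ^ 2 - 3 * r ≠ 0) :
    ∃ x, x ^ 3 + p * x ^ 2 + r * x + s = 0 ∧ 3 * x ^ 2 + 2 * p * x + r = 0 ∧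
      p' * x ^ 2 + r' * x + s' = 0 := by
  rw [cubicDisc] at hD
  obtain ⟨x, hx⟩ : ∃ x, 2 * (p ^ 2 - 3 * r) * x = 9 * s - p * r :=
    ⟨(9 * s - p * r) / (2 * (p ^ 2 - 3 * r)), by field_simp⟩
  have hF' : 3 * x ^ 2 + 2 * p * x + r = 0 := by
    have h4 : (2 * (p ^ 2 - 3 * r)) ^ 2 ≠ 0 := pow_ne_zero _ (mul_ne_zero h2 hH)
    refine (mul_eq_zero.mp ?_).resolve_left h4
    have : (2 * (p ^ 2 - 3 * r)) ^ 2 * (3 * x ^ 2 + 2 * p * x + r) =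
        3 * (9 * s - p * r) ^ 2 + 2 * p * (2 * (p ^ 2 - 3 * r)) * (9 * s - p * r) +
          (2 * (p ^ 2 - 3 * r)) ^ 2 * r := by
      rw [← hx]; ring
    rw [this]
    linear_combination (-9) * hD
  have hr : r = -(3 * x ^ 2 + 2 * p * x) := by linear_combination hF'
  have hsx : s = 2 * x ^ 3 + p * x ^ 2 ∨ (9 : K) = 0 := by
    by_cases h9 : (9 : K) = 0
    · exact Or.inr h9
    · refine Or.inl (mul_left_cancel₀ h9 ?_)
      rw [hr] at hx
      linear_combination -hx
  have hs : s = 2 * x ^ 3 + p * x ^ 2 := by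
    rcases hsx with h | h9
    · exact h
    · have h3 : (3 : K) = 0 := by
        have : (3 : K) * 3 = 0 := by linear_combination h9
        rcases mul_eq_zero.mp this with h | h <;> exact h
      have hp : p ≠ 0 := by
        rintro rfl
        exact hH (by linear_combination -r * h3)
      have hp3 : 4 * p ^ 3 ≠ 0 := mul_ne_zero (by
        rw [show (4 : K) = 2 * 2 by norm_num]
        exact mul_ne_zero h2 h2) (pow_ne_zero _ hp)
      refine mul_left_cancel₀ hp3 ?_
      have hr3 : r = -(2 * p * x) := by linear_combination hF' - x ^ 2 * h3
      rw [hr3] at hD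
      linear_combination -hD + (-12 * p ^ 2 * x * s - 9 * s ^ 2 + 8 * p ^ 3 * x ^ 3 * 0) * h3 +
        (8 * p ^ 3 * x ^ 3) * h3
  refine ⟨x, by rw [hs, hr]; ring, hF', ?_⟩
  have hH3 : 4 * (p ^ 2 - 3 * r) * (p + 3 * x) ≠ 0 := by
    have h1 : p ^ 2 - 3 * r = (p + 3 * x) ^ 2 := by rw [hr]; ring
    rw [h1] at hH ⊢
    have h0 : p + 3 * x ≠ 0 := fun h => hH (by rw [h]; ring)
    rw [show (4 : K) = 2 * 2 by norm_num]
    exact mul_ne_zero (mul_ne_zero (mul_ne_zero h2 h2) hH) h0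
  refine (mul_eq_zero.mp ?_).resolve_left hH3
  rw [hs, hr] at hD'
  rw [hr]
  linear_combination -hD'

lemma derivative_cubicDisc {K : Type*} [Field K] (P R S : K[X]) :
    derivative (cubicDisc P R S) =
      (2 * P * R ^ 2 - 12 * P ^ 2 * S + 18 * R * S) * derivative P +
      (2 * P ^ 2 * R - 12 * R ^ 2 + 18 * P * S) * derivative R +
      (-4 * P ^ 3 + 18 * P * R - 54 * S) * derivative S := by
  simp only [cubicDisc, derivative_sub, derivative_add, derivative_mul, derivative_pow,
    derivative_ofNat, Nat.cast_ofNat, map_ofNat]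
  ring

lemma eval_cubicDisc {K : Type*} [Field K] (P R S : K[X]) (t : K) :
    (cubicDisc P R S).eval t = cubicDisc (P.eval t) (R.eval t) (S.eval t) := by
  simp [cubicDisc]

lemma exists_double_root_of_eq_C_mul_sq {K : Type*} [Field K] (h2 : (2 : K) ≠ 0) {P R S h : K[X]}
    {c t : K} (hD : cubicDisc P R S = C c * h ^ 2) (ht : h.IsRoot t)
    (hH : P.eval t ^ 2 - 3 * R.eval t ≠ 0) :
    ∃ x, x ^ 3 + P.eval t * x ^ 2 + R.eval t * x + S.eval t = 0 ∧
      3 * x ^ 2 + 2 * P.eval t * x + R.eval t = 0 ∧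
      (derivative P).eval t * x ^ 2 + (derivative R).eval t * x + (derivative S).eval t = 0 := by
  refine exists_double_root h2 ?_ ?_ hH
  · rw [← eval_cubicDisc, hD]
    simp [ht.eq_zero]
  · have h1 := congrArg (eval t) (congrArg derivative hD)
    rw [derivative_cubicDisc, sq h] at h1
    simpa [ht.eq_zero] using h1

lemma triple_root_of_eq_C_mul_sq {K : Type*} [Field K] (h3 : (3 : K) ≠ 0) {P R S h : K[X]}
    {c t : K} (hD : cubicDisc P R S = C c * h ^ 2) (ht : h.IsRoot t)
    (hH : P.eval t ^ 2 - 3 * R.eval t = 0) :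
    ∃ x, P.eval t = -3 * x ∧ R.eval t = 3 * x ^ 2 ∧ S.eval t = -x ^ 3 := by
  have h0 : cubicDisc (P.eval t) (R.eval t) (S.eval t) = 0 := by
    rw [← eval_cubicDisc, hD]
    simp [ht.eq_zero]
  obtain ⟨x, hx⟩ : ∃ x, P.eval t = -3 * x := ⟨-P.eval t / 3, by field_simp⟩
  have hR : R.eval t = 3 * x ^ 2 := by
    refine mul_left_cancel₀ h3 ?_
    rw [hx] at hH
    linear_combination -hH
  refine ⟨x, hx, hR, ?_⟩
  rw [hx, hR, cubicDisc] at h0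
  have h1 : (3 * (S.eval t + x ^ 3)) ^ 2 * 3 = 0 := by linear_combination -h0
  have h4 := (mul_eq_zero.mp h1).resolve_right h3
  rw [sq_eq_zero_iff] at h4
  linear_combination (mul_eq_zero.mp h4).resolve_left h3

lemma not_sq_dvd_of_eq_C_mul_sq {K : Type*} [Field K] {P R S h : K[X]}
    {c t : K} (hD : cubicDisc P R S = C c * h ^ 2)
    (hH : (P ^ 2 - 3 * R).IsRoot t)
    (hK : (derivative (2 * P ^ 3 - 9 * P * R + 27 * S)).eval t ≠ 0) : ¬ (X - C t) ^ 2 ∣ h := by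
  intro hdvd
  obtain ⟨k, hk⟩ := hdvd
  obtain ⟨l, hl⟩ := dvd_iff_isRoot.mpr hH
  have h1 : (2 * P ^ 3 - 9 * P * R + 27 * S) ^ 2 =
      (X - C t) ^ 3 * (4 * l ^ 3 - 27 * (C c * (X - C t) * k ^ 2)) := by
    have : (2 * P ^ 3 - 9 * P * R + 27 * S) ^ 2 =
        4 * (P ^ 2 - 3 * R) ^ 3 - 27 * cubicDisc P R S := by
      rw [cubicDisc]; ring
    rw [this, hD, hk, hl]
    ring
  have hprime : Prime (X - C t) := prime_X_sub_C t
  have h2 : (X - C t) ^ 2 ∣ 2 * P ^ 3 - 9 * P * R + 27 * S := by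
    obtain ⟨m, hm⟩ : X - C t ∣ 2 * P ^ 3 - 9 * P * R + 27 * S :=
      hprime.dvd_of_dvd_pow (n := 2) (by
        rw [h1]; exact (dvd_pow_self _ three_ne_zero).mul_right _)
    rw [hm, mul_pow, pow_succ (X - C t) 2, mul_assoc] at h1
    have h5 := mul_left_cancel₀ (pow_ne_zero 2 hprime.ne_zero) h1
    have h6 : X - C t ∣ m := hprime.dvd_of_dvd_pow (Dvd.intro _ h5.symm)
    rw [hm, sq]
    exact mul_dvd_mul_left _ h6
  obtain ⟨m, hm⟩ := h2
  apply hK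
  rw [hm, sq]
  simp

lemma natDegree_C_mul_sq {K : Type*} [Field K] {D h : K[X]} {c : K} (hD : D = C c * h ^ 2)
    (h0 : D ≠ 0) : D.natDegree = 2 * h.natDegree := by
  have hc : c ≠ 0 := by
    rintro rfl
    simp [hD] at h0
  rw [hD, natDegree_C_mul hc, natDegree_pow]

lemma card_roots_toFinset_of_not_sq_dvd {K : Type*} [Field K] [IsAlgClosed K] [DecidableEq K]
    {h : K[X]} (h0 : h ≠ 0) (hs : ∀ t, h.IsRoot t → ¬ (X - C t) ^ 2 ∣ h) :
    h.roots.toFinset.card = h.natDegree := by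
  rw [Multiset.toFinset_card_of_nodup, ← (IsAlgClosed.splits h).natDegree_eq_card_roots]
  rw [Multiset.nodup_iff_count_le_one]
  intro t
  rw [count_roots]
  by_contra! hlt
  refine hs t ?_ ?_
  · exact (rootMultiplicity_pos h0).mp (by omega)
  · exact (pow_dvd_pow _ hlt).trans (pow_rootMultiplicity_dvd h t)

lemma cubicDisc_affine_expand {K : Type*} [Field K] (a b e v : K) :
    cubicDisc (C a - X ^ 2) (C b - C (2 * v) * X) (C e) =
      C (4 * v ^ 2 + 4 * e) * X ^ 6 + C (-4 * b * v) * X ^ 5 +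
      C (b ^ 2 - 8 * a * v ^ 2 - 12 * a * e) * X ^ 4 +
      C (8 * a * b * v + 32 * v ^ 3 + 36 * e * v) * X ^ 3 +
      C (-2 * a * b ^ 2 + 4 * a ^ 2 * v ^ 2 - 48 * b * v ^ 2 + 12 * a ^ 2 * e - 18 * e * b) * X ^ 2 +
      C (-4 * a ^ 2 * b * v + 24 * b ^ 2 * v - 36 * e * a * v) * X +
      C (a ^ 2 * b ^ 2 - 4 * b ^ 3 - 4 * a ^ 3 * e + 18 * e * a * b - 27 * e ^ 2) := by
  simp only [cubicDisc, map_sub, map_add, map_mul, map_pow, map_ofNat, map_neg]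
  ring

lemma affine_root {K : Type*} [Field K] (h2 : (2 : K) ≠ 0) {a b e v c t : K} {h : K[X]}
    (he : e ≠ 0) (hd : cubicDisc a b (e + v ^ 2) ≠ 0)
    (hD : cubicDisc (C a - X ^ 2) (C b - C (2 * v) * X) (C e) = C c * h ^ 2) (ht : h.IsRoot t) :
    (a - t ^ 2) ^ 2 - 3 * (b - 2 * v * t) = 0 := by
  by_contra hH
  obtain ⟨x, h1, h3, h4⟩ := exists_double_root_of_eq_C_mul_sq h2 hD ht (by simpa using hH)
  simp only [eval_sub, eval_C, eval_pow, eval_X, eval_mul, derivative_sub, derivative_C,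
    derivative_X_pow, derivative_mul, derivative_X, Nat.cast_ofNat] at h1 h3 h4
  have hx : x ≠ 0 := by
    rintro rfl
    exact he (by linear_combination h1)
  have hv : t * x + v = 0 := by
    have : 2 * x * (t * x + v) = 0 := by
      simp at h4
      linear_combination -h4
    exact (mul_eq_zero.mp this).resolve_left (mul_ne_zero h2 hx)
  have hv' : v = -(t * x) := by linear_combination hv
  subst hv'
  refine hd (cubicDisc_eq_zero_of_double_root (x := x) ?_ ?_)
  · linear_combination h1
  · linear_combination h3

lemma affine_root_simple {K : Type*} [Field K] (h2 : (2 : K) ≠ 0) (h3 : (3 : K) ≠ 0)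
    {a b e v c t : K} {h : K[X]}
    (he : e ≠ 0) (hd : cubicDisc a b (e + v ^ 2) ≠ 0)
    (hD : cubicDisc (C a - X ^ 2) (C b - C (2 * v) * X) (C e) = C c * h ^ 2) (ht : h.IsRoot t) :
    (∃ x, t ^ 2 = a + 3 * x ∧ b - 2 * v * t = 3 * x ^ 2 ∧ e = -x ^ 3) ∧
      ¬ (X - C t) ^ 2 ∣ h := by
  have hH := affine_root h2 he hd hD ht
  obtain ⟨x, hp, hr, hs⟩ := triple_root_of_eq_C_mul_sq h3 hD ht (by simpa using hH)
  simp only [eval_sub, eval_C, eval_pow, eval_X, eval_mul] at hp hr hs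
  refine ⟨⟨x, by linear_combination -hp, hr, hs⟩, ?_⟩
  refine not_sq_dvd_of_eq_C_mul_sq hD (by simpa [IsRoot] using hH) ?_
  have hx : x ≠ 0 := by
    rintro rfl
    exact he (by rw [hs]; ring)
  have hv : t * x + v ≠ 0 := by
    intro hv
    have hv' : v = -(t * x) := by linear_combination hv
    subst hv'
    refine hd (cubicDisc_eq_zero_of_double_root (x := x) ?_ ?_)
    · linear_combination x * hr + hs + x ^ 2 * hp
    · linear_combination hr + 2 * x * hp
  have h54 : 2 * (3 * 3 * 3) * x * (t * x + v) ≠ 0 :=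
    mul_ne_zero (mul_ne_zero (mul_ne_zero h2 (mul_ne_zero (mul_ne_zero h3 h3) h3)) hx) hv
  intro h0
  apply h54
  simp only [eval_sub, eval_C, eval_pow, eval_X, eval_mul, derivative_sub, derivative_C,
    derivative_add, eval_add, derivative_pow, eval_ofNat, derivative_ofNat, map_ofNat,
    derivative_mul, derivative_X, Nat.cast_ofNat] at h0
  simp at h0
  have hp' : a = t ^ 2 - 3 * x := by linear_combination hp
  have hr' : b = 2 * v * t + 3 * x ^ 2 := by linear_combination hr
  subst hp' hr'
  linear_combination -h0

lemma affine_not_sq_of_char_ne_three {K : Type*} [Field K] [IsAlgClosed K] (h2 : (2 : K) ≠ 0)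
    (h3 : (3 : K) ≠ 0) {a b e v : K} (he : e ≠ 0) (hab : a ^ 2 ≠ 3 * b)
    (hd : cubicDisc a b (e + v ^ 2) ≠ 0) (c : K) (h : K[X]) :
    cubicDisc (C a - X ^ 2) (C b - C (2 * v) * X) (C e) ≠ C c * h ^ 2 := by
  classical
  intro hD
  have key := fun t (ht : h.IsRoot t) => affine_root_simple h2 h3 he hd hD ht
  have hexp := cubicDisc_affine_expand a b e v
  set D := cubicDisc (C a - X ^ 2) (C b - C (2 * v) * X) (C e) with hDdef
  have hx0 : ∀ x, e = -x ^ 3 → x ≠ 0 := by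
    rintro x hx rfl
    exact he (by rw [hx]; ring)
  have h4 : (4 : K) ≠ 0 := by
    rw [show (4 : K) = 2 * 2 by norm_num]; exact mul_ne_zero h2 h2
  -- two roots sharing the triple point
  have opp : ∀ t t' x, t ≠ t' → t ^ 2 = a + 3 * x → t' ^ 2 = a + 3 * x → b - 2 * v * t = 3 * x ^ 2 →
      b - 2 * v * t' = 3 * x ^ 2 → t' = -t ∧ v = 0 := by
    intro t t' x hne h1 h1' h5 h5'
    have ht : t' = -t := by
      have : (t - t') * (t + t') = 0 := by linear_combination h1 - h1'
      rcases mul_eq_zero.mp this with h | h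
      · exact absurd (sub_eq_zero.mp h) hne
      · linear_combination h
    refine ⟨ht, ?_⟩
    have ht0 : t ≠ 0 := by
      rintro rfl
      exact hne (by rw [ht, neg_zero])
    have : 4 * t * v = 0 := by rw [ht] at h5'; linear_combination h5' - h5
    exact (mul_eq_zero.mp this).resolve_left (mul_ne_zero h4 ht0)
  by_cases hd6 : 4 * v ^ 2 + 4 * e = 0
  · have hev : e = -v ^ 2 := by
      refine mul_left_cancel₀ h4 ?_
      linear_combination hd6
    have hv : v ≠ 0 := by
      rintro rfl
      exact he (by rw [hev]; ring)
    rw [hd6, C_0, zero_mul, zero_add] at hexp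
    have hb : b = 0 := by
      by_contra hb
      have hdeg : D.natDegree = 5 := by
        rw [hexp]
        have : -4 * b * v ≠ 0 := mul_ne_zero (mul_ne_zero (neg_ne_zero.mpr h4) hb) hv
        compute_degree!
      have := natDegree_C_mul_sq hD (by rintro h; simp [h] at hdeg)
      omega
    have ha : a ≠ 0 := by
      rintro rfl
      exact hab (by rw [hb]; ring)
    have hdeg : D.natDegree = 4 := by
      rw [hexp, hb]
      have : -(8 * a * v ^ 2) - 12 * a * e ≠ 0 := by
        rw [hev]
        have : 4 * a * v ^ 2 ≠ 0 := mul_ne_zero (mul_ne_zero h4 ha) (pow_ne_zero 2 hv)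
        intro h; apply this; linear_combination h
      simp only [mul_zero, zero_mul, map_zero, zero_add, zero_pow two_ne_zero, zero_sub]
      compute_degree!
    have hdh := natDegree_C_mul_sq hD (by rintro h; simp [h] at hdeg)
    have hh0 : h ≠ 0 := by rintro rfl; simp at hdh; omega
    have hcard := card_roots_toFinset_of_not_sq_dvd hh0 (fun t ht => (key t ht).2)
    obtain ⟨t₁, t₂, h12, hs⟩ := Finset.card_eq_two.mp (hcard.trans (show h.natDegree = 2 by omega))
    have hroot : ∀ t ∈ ({t₁, t₂} : Finset K), h.IsRoot t := by
      intro t ht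
      rw [← hs] at ht
      simpa [hh0] using ht
    obtain ⟨x₁, p₁, r₁, s₁⟩ := (key t₁ (hroot t₁ (by simp))).1
    obtain ⟨x₂, p₂, r₂, s₂⟩ := (key t₂ (hroot t₂ (by simp))).1
    have hx : ∀ t x, t ^ 2 = a + 3 * x → b - 2 * v * t = 3 * x ^ 2 → e = -x ^ 3 →
        3 * x = -4 * a := by
      intro t x p r s
      have hx := hx0 x s
      have hv3 : v ^ 2 = x ^ 3 := by linear_combination hev - s
      have h9 : x ^ 3 * (3 * (3 * x)) = x ^ 3 * (4 * t ^ 2) := by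
        rw [hb] at r
        linear_combination (2 * v * t - 3 * x ^ 2) * r + 4 * t ^ 2 * hv3
      have := mul_left_cancel₀ (pow_ne_zero 3 hx) h9
      linear_combination -this - 4 * p
    have hxx : x₁ = x₂ := mul_left_cancel₀ h3 ((hx _ _ p₁ r₁ s₁).trans (hx _ _ p₂ r₂ s₂).symm)
    subst hxx
    exact hv (opp t₁ t₂ x₁ h12 p₁ p₂ r₁ r₂).2
  · have hdeg : D.natDegree = 6 := by
      rw [hexp]
      compute_degree!
    have hdh := natDegree_C_mul_sq hD (by rintro h; simp [h] at hdeg)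
    have hh0 : h ≠ 0 := by rintro rfl; simp at hdh; omega
    have hcard := card_roots_toFinset_of_not_sq_dvd hh0 (fun t ht => (key t ht).2)
    obtain ⟨t₁, t₂, t₃, h12, h13, h23, hs⟩ :=
      Finset.card_eq_three.mp (hcard.trans (show h.natDegree = 3 by omega))
    have hroot : ∀ t ∈ ({t₁, t₂, t₃} : Finset K), h.IsRoot t := by
      intro t ht
      rw [← hs] at ht
      simpa [hh0] using ht
    obtain ⟨x₁, p₁, r₁, s₁⟩ := (key t₁ (hroot t₁ (by simp))).1
    obtain ⟨x₂, p₂, r₂, s₂⟩ := (key t₂ (hroot t₂ (by simp))).1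
    obtain ⟨x₃, p₃, r₃, s₃⟩ := (key t₃ (hroot t₃ (by simp))).1
    have noeq : ∀ t t' t'' x x'', t ≠ t' → t ≠ t'' → t' ≠ t'' → t ^ 2 = a + 3 * x →
        t' ^ 2 = a + 3 * x → t'' ^ 2 = a + 3 * x'' → b - 2 * v * t = 3 * x ^ 2 →
        b - 2 * v * t' = 3 * x ^ 2 → b - 2 * v * t'' = 3 * x'' ^ 2 → e = -x ^ 3 →
        e = -x'' ^ 3 → False := by
      intro t t' t'' x x'' n1 n2 n3 p p' p'' r r' r'' s s''
      obtain ⟨ht, hv⟩ := opp t t' x n1 p p' r r'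
      rw [hv] at r r''
      have hxx : x'' = x := by
        have : 3 * ((x'' - x) * (x'' + x)) = 0 := by linear_combination r - r''
        rcases mul_eq_zero.mp ((mul_eq_zero.mp this).resolve_left h3) with h | h
        · exact sub_eq_zero.mp h
        · have hx : x'' = -x := by linear_combination h
          rw [hx] at s''
          have : 2 * e = 0 := by linear_combination s + s''
          exact absurd ((mul_eq_zero.mp this).resolve_left h2) he
      have : (t - t'') * (t' - t'') = 0 := by
        rw [ht]; rw [hxx] at p''
        linear_combination p'' - p
      rcases mul_eq_zero.mp this with h | h
      · exact n2 (sub_eq_zero.mp h)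
      · exact n3 (sub_eq_zero.mp h)
    have x12 : x₁ ≠ x₂ := by
      rintro rfl
      exact noeq t₁ t₂ t₃ x₁ x₃ h12 h13 h23 p₁ p₂ p₃ r₁ r₂ r₃ s₁ s₃
    have x13 : x₁ ≠ x₃ := by
      rintro rfl
      exact noeq t₁ t₃ t₂ x₁ x₂ h13 h12 h23.symm p₁ p₃ p₂ r₁ r₃ r₂ s₁ s₂
    have x23 : x₂ ≠ x₃ := by
      rintro rfl
      exact noeq t₂ t₃ t₁ x₂ x₁ h23 h12.symm h13.symm p₂ p₃ p₁ r₂ r₃ r₁ s₂ s₁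
    have hq : ∀ t x, t ^ 2 = a + 3 * x → b - 2 * v * t = 3 * x ^ 2 → e = -x ^ 3 →
        -6 * b * x ^ 2 - (9 * e + 12 * v ^ 2) * x + (b ^ 2 - 4 * v ^ 2 * a) = 0 := by
      intro t x p r s
      linear_combination 4 * v ^ 2 * p + (b - 3 * x ^ 2 + 2 * v * t) * r - 9 * x * s
    have q₁ := hq _ _ p₁ r₁ s₁
    have q₂ := hq _ _ p₂ r₂ s₂
    have q₃ := hq _ _ p₃ r₃ s₃
    have l12 : -6 * b * (x₁ + x₂) - (9 * e + 12 * v ^ 2) = 0 :=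
      (mul_eq_zero.mp (show (x₁ - x₂) * _ = 0 by linear_combination q₁ - q₂)).resolve_left
        (sub_ne_zero.mpr x12)
    have l13 : -6 * b * (x₁ + x₃) - (9 * e + 12 * v ^ 2) = 0 :=
      (mul_eq_zero.mp (show (x₁ - x₃) * _ = 0 by linear_combination q₁ - q₃)).resolve_left
        (sub_ne_zero.mpr x13)
    have hb : b = 0 := by
      have : (2 * 3) * (x₂ - x₃) * b = 0 := by linear_combination l13 - l12
      exact (mul_eq_zero.mp this).resolve_left
        (mul_ne_zero (mul_ne_zero h2 h3) (sub_ne_zero.mpr x23))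
    rw [hb] at l12 q₁
    have hv : v ≠ 0 := by
      rintro rfl
      have : (3 * 3) * e = 0 := by linear_combination -l12
      exact he ((mul_eq_zero.mp this).resolve_left (mul_ne_zero h3 h3))
    have ha : 4 * v ^ 2 * a = 0 := by linear_combination -q₁ + x₁ * l12
    have ha' := (mul_eq_zero.mp ha).resolve_left (mul_ne_zero h4 (pow_ne_zero 2 hv))
    exact hab (by rw [ha', hb]; ring)

lemma natDegree_eq_zero_of_forall_not_isRoot {K : Type*} [Field K] [IsAlgClosed K] {h : K[X]}
    (hr : ∀ t, ¬ h.IsRoot t) : h.natDegree = 0 := by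
  by_contra hne
  obtain ⟨t, ht⟩ := IsAlgClosed.exists_root h (fun h0 => hne (natDegree_eq_of_degree_eq_some h0))
  exact hr t ht

lemma affine_not_sq_of_char_three {K : Type*} [Field K] [IsAlgClosed K] (h2 : (2 : K) ≠ 0)
    (h3 : (3 : K) = 0) {a b e v : K} (he : e ≠ 0) (hab : a ^ 2 ≠ 3 * b)
    (hd : cubicDisc a b (e + v ^ 2) ≠ 0) (c : K) (h : K[X]) :
    cubicDisc (C a - X ^ 2) (C b - C (2 * v) * X) (C e) ≠ C c * h ^ 2 := by
  classical
  intro hD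
  have h4 : (4 : K) ≠ 0 := by
    rw [show (4 : K) = 2 * 2 by norm_num]; exact mul_ne_zero h2 h2
  have ha : a ≠ 0 := by
    rintro rfl
    exact hab (by rw [h3]; ring)
  have key : ∀ t, h.IsRoot t → t ^ 2 = a ∧ b = 2 * v * t := by
    intro t ht
    have hH := affine_root h2 he hd hD ht
    have hp : (a - t ^ 2) ^ 2 = 0 := by linear_combination hH + (b - 2 * v * t) * h3
    have hp' : a - t ^ 2 = 0 := by simpa using hp
    have hD0 := congrArg (eval t) hD
    rw [eval_cubicDisc] at hD0
    simp only [eval_sub, eval_C, eval_pow, eval_X, eval_mul, ht.eq_zero, hp', cubicDisc] at hD0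
    have hr : 4 * (b - 2 * v * t) ^ 3 = 0 := by
      linear_combination -hD0 - 9 * e ^ 2 * h3
    refine ⟨by linear_combination -hp', ?_⟩
    have := pow_eq_zero_iff three_ne_zero |>.mp ((mul_eq_zero.mp hr).resolve_left h4)
    linear_combination this
  have hexp := cubicDisc_affine_expand a b e v
  set D := cubicDisc (C a - X ^ 2) (C b - C (2 * v) * X) (C e) with hDdef
  have c6 : D.coeff 6 = 4 * v ^ 2 + 4 * e := by rw [hexp]; simp only [coeff_add, coeff_C_mul, coeff_X_pow, coeff_X, coeff_C]; simp
  have c5 : D.coeff 5 = -4 * b * v := by rw [hexp]; simp only [coeff_add, coeff_C_mul, coeff_X_pow, coeff_X, coeff_C]; simp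
  have c3 : D.coeff 3 = 8 * a * b * v + 32 * v ^ 3 + 36 * e * v := by
    rw [hexp]; simp only [coeff_add, coeff_C_mul, coeff_X_pow, coeff_X, coeff_C]; simp
  have hroot : ∃ t, h.IsRoot t := by
    by_contra! hr
    have hh : D.natDegree = 0 := by
      rw [hD, eq_C_of_natDegree_eq_zero (natDegree_eq_zero_of_forall_not_isRoot hr), ← C_pow,
        ← C_mul, natDegree_C]
    have h6 := c6.symm.trans (coeff_eq_zero_of_natDegree_lt (by omega))
    have h5 := c5.symm.trans (coeff_eq_zero_of_natDegree_lt (by omega))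
    have h3' := c3.symm.trans (coeff_eq_zero_of_natDegree_lt (by omega))
    have hv : v = 0 := by
      have : 2 ^ 5 * v ^ 3 = 0 := by linear_combination h3' + 2 * a * h5 - 12 * e * v * h3
      simpa [h2] using this
    rw [hv] at h6
    exact mul_ne_zero h4 he (by linear_combination h6)
  obtain ⟨t, ht⟩ := hroot
  obtain ⟨hta, hbt⟩ := key t ht
  have ht0 : t ≠ 0 := by
    rintro rfl
    exact ha (by rw [← hta]; ring)
  by_cases hv : v = 0
  · subst hv
    have hb : b = 0 := by rw [hbt]; ring
    have h3X : (3 : K[X]) = 0 := by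
      rw [← map_ofNat C, h3, C_0]
    have hP : D = C (-4 * e) * (C a - X ^ 2) ^ 3 := by
      rw [hDdef, hb, cubicDisc]
      simp only [map_mul, map_neg, map_ofNat, mul_zero, C_0]
      linear_combination - 9 * C e ^ 2 * h3X
    have hroots := congrArg (Multiset.count t) (congrArg roots (hP.symm.trans hD))
    have hc : c ≠ 0 := by
      rintro rfl
      have := c6
      rw [hD] at this
      simp only [C_0, zero_mul, coeff_zero] at this
      exact mul_ne_zero h4 he (by linear_combination -this)
    rw [roots_C_mul _ (mul_ne_zero (neg_ne_zero.mpr h4) he), roots_C_mul _ hc, roots_pow,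
      roots_pow, Multiset.count_nsmul, Multiset.count_nsmul, count_roots, count_roots] at hroots
    have hP0 : C a - X ^ 2 ≠ 0 := by
      intro h
      have := congrArg (fun p => coeff p 2) h
      simp at this
    have hPt : (C a - X ^ 2 : K[X]).IsRoot t := by simp [hta]
    have hpos := (rootMultiplicity_pos hP0).mpr hPt
    have hder := ((one_lt_rootMultiplicity_iff_isRoot hP0 (t := t)).mp (by omega)).2
    simp [IsRoot] at hder
    rcases hder with h | h
    · exact h2 (by linear_combination h)
    · exact ht0 h
  · have hb : b ≠ 0 := by
      rw [hbt]
      exact mul_ne_zero (mul_ne_zero h2 hv) ht0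
    have hc5 : D.coeff 5 ≠ 0 := by
      rw [c5]
      exact mul_ne_zero (mul_ne_zero (neg_ne_zero.mpr h4) hb) hv
    have hD0 : D ≠ 0 := by rintro h; simp [h] at hc5
    have hdh := natDegree_C_mul_sq hD hD0
    have hle6 : D.natDegree ≤ 6 := by
      rw [hexp]
      compute_degree
    have hge5 := le_natDegree_of_ne_zero hc5
    have hall : h.roots = Multiset.replicate 3 t := by
      rw [Multiset.eq_replicate, ← (IsAlgClosed.splits h).natDegree_eq_card_roots]
      refine ⟨by omega, fun s hs => ?_⟩
      have := (key s (isRoot_of_mem_roots hs)).2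
      refine mul_left_cancel₀ (mul_ne_zero h2 hv) ?_
      rw [← this, ← hbt]
    have hsp := (IsAlgClosed.splits h).eq_prod_roots
    rw [hall, Multiset.map_replicate, Multiset.prod_replicate] at hsp
    have h3X : (3 : K[X]) = 0 := by
      rw [← map_ofNat C, h3, C_0]
    have hcube : (X - C t) ^ 3 = X ^ 3 - C (t ^ 3) := by
      rw [C_pow]
      linear_combination (-X ^ 2 * C t + X * C t ^ 2) * h3X
    apply hc5
    have : D = C (c * h.leadingCoeff ^ 2) * (X ^ 6 - C (2 * t ^ 3) * X ^ 3 + C (t ^ 6)) := by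
      rw [hD]
      conv_lhs => rw [hsp, hcube]
      simp only [map_mul, map_pow, map_ofNat]
      ring
    rw [this]
    simp only [coeff_add, coeff_sub, coeff_C_mul, coeff_X_pow, coeff_C]
    simp

lemma cubicDisc_affine_not_sq {K : Type*} [Field K] [IsAlgClosed K] (h2 : (2 : K) ≠ 0)
    {a b e v : K} (he : e ≠ 0) (hab : a ^ 2 ≠ 3 * b)
    (hd : cubicDisc a b (e + v ^ 2) ≠ 0) (c : K) (h : K[X]) :
    cubicDisc (C a - X ^ 2) (C b - C (2 * v) * X) (C e) ≠ C c * h ^ 2 := by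
  by_cases h3 : (3 : K) = 0
  · exact affine_not_sq_of_char_three h2 h3 he hab hd c h
  · exact affine_not_sq_of_char_ne_three h2 h3 he hab hd c h

lemma cubicDisc_infinity_not_sq {K : Type*} [Field K] [IsAlgClosed K] (h2 : (2 : K) ≠ 0)
    {a b s m : K} (hab : a ^ 2 ≠ 3 * b) (hd : cubicDisc a b s ≠ 0) (c : K) (h : K[X]) :
    cubicDisc (C (a - m ^ 2)) (C b - C (2 * m) * X) (C s - X ^ 2) ≠ C c * h ^ 2 := by
  classical
  intro hD
  have h4 : (4 : K) ≠ 0 := by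
    rw [show (4 : K) = 2 * 2 by norm_num]; exact mul_ne_zero h2 h2
  obtain ⟨p, hp⟩ : ∃ p, p = a - m ^ 2 := ⟨_, rfl⟩
  rw [← hp] at hD
  have hap : a = p + m ^ 2 := by rw [hp]; ring
  have key : ∀ t, h.IsRoot t → p ^ 2 - 3 * (b - 2 * m * t) = 0 := by
    intro t ht
    by_contra hH
    obtain ⟨x, e1, e2, e3⟩ := exists_double_root_of_eq_C_mul_sq h2 hD ht (by simpa using hH)
    simp only [eval_sub, eval_C, eval_pow, eval_X, eval_mul, derivative_sub, derivative_C,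
      derivative_X_pow, derivative_mul, derivative_X, Nat.cast_ofNat] at e1 e2 e3
    have hmx : m * x + t = 0 := by
      have : 2 * (m * x + t) = 0 := by
        simp at e3
        linear_combination -e3
      exact (mul_eq_zero.mp this).resolve_left h2
    have ht' : t = -(m * x) := by linear_combination hmx
    subst ht'
    refine hd (cubicDisc_eq_zero_of_double_root (x := x) ?_ ?_)
    · rw [hap]; linear_combination e1
    · rw [hap]; linear_combination e2
  have hexp : cubicDisc (C p) (C b - C (2 * m) * X) (C s - X ^ 2) =
      C (-27) * X ^ 4 + C (32 * m ^ 3 + 36 * p * m) * X ^ 3 +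
      C (54 * s + 4 * m ^ 2 * p ^ 2 - 48 * b * m ^ 2 + 4 * p ^ 3 - 18 * p * b) * X ^ 2 +
      C (-4 * p ^ 2 * b * m + 24 * b ^ 2 * m - 36 * p * m * s) * X +
      C (p ^ 2 * b ^ 2 - 4 * b ^ 3 - 4 * p ^ 3 * s + 18 * p * b * s - 27 * s ^ 2) := by
    simp only [cubicDisc, map_sub, map_add, map_mul, map_pow, map_ofNat, map_neg]
    ring
  set D := cubicDisc (C p) (C b - C (2 * m) * X) (C s - X ^ 2) with hDdef
  by_cases h3 : (3 : K) = 0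
  · have h27 : (-27 : K) = 0 := by linear_combination (-9) * h3
    by_cases hm : m = 0
    · subst hm
      have ha : a ≠ 0 := by
        rintro rfl
        exact hab (by rw [h3]; ring)
      have hpa : p = a := by rw [hp]; ring
      obtain ⟨t, ht⟩ : ∃ t, h.IsRoot t := by
        by_contra! hr
        have hh : D.natDegree = 0 := by
          rw [hD, eq_C_of_natDegree_eq_zero (natDegree_eq_zero_of_forall_not_isRoot hr), ← C_pow,
            ← C_mul, natDegree_C]
        have c2 : D.coeff 2 = 54 * s + 4 * p ^ 3 - 18 * p * b := by
          rw [hexp]; simp only [coeff_add, coeff_C_mul, coeff_X_pow, coeff_X, coeff_C]; simp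
        have h2' := c2.symm.trans (coeff_eq_zero_of_natDegree_lt (by omega))
        have : 4 * a ^ 3 = 0 := by rw [hpa] at h2'; linear_combination h2' - (18 * s - 6 * a * b) * h3
        exact mul_ne_zero h4 (pow_ne_zero 3 ha) this
      have := key t ht
      rw [hpa] at this
      exact hab (by linear_combination this)
    · have hdeg : D.natDegree = 3 := by
        rw [hexp, h27, C_0, zero_mul, zero_add]
        have : 32 * m ^ 3 + 36 * p * m ≠ 0 := by
          have : 2 ^ 5 * m ^ 3 ≠ 0 := mul_ne_zero (pow_ne_zero 5 h2) (pow_ne_zero 3 hm)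
          intro h; apply this; linear_combination h - 12 * p * m * h3
        compute_degree!
      have := natDegree_C_mul_sq hD (by rintro h; simp [h] at hdeg)
      omega
  · have hdeg : D.natDegree = 4 := by
      rw [hexp]
      have : (27 : K) ≠ 0 := by
        rw [show (27 : K) = 3 * 3 * 3 by norm_num]
        exact mul_ne_zero (mul_ne_zero h3 h3) h3
      compute_degree!
    have hdh := natDegree_C_mul_sq hD (by rintro h; simp [h] at hdeg)
    have hh0 : h ≠ 0 := by rintro rfl; simp at hdh; omega
    have hsimple : ∀ t, h.IsRoot t → ¬ (X - C t) ^ 2 ∣ h := by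
      intro t ht
      have hH := key t ht
      obtain ⟨x, e1, e2, e3⟩ := triple_root_of_eq_C_mul_sq h3 hD ht (by simpa using hH)
      simp only [eval_sub, eval_C, eval_pow, eval_X, eval_mul] at e1 e2 e3
      refine not_sq_dvd_of_eq_C_mul_sq hD (by simpa [IsRoot] using hH) ?_
      have hv : m * x + t ≠ 0 := by
        intro hv
        have hv' : t = -(m * x) := by linear_combination hv
        subst hv'
        refine hd (cubicDisc_eq_zero_of_double_root (x := x) ?_ ?_)
        · rw [hap]; linear_combination x * e2 + e3 + x ^ 2 * e1
        · rw [hap]; linear_combination e2 + 2 * x * e1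
      have h54 : 2 * (3 * 3 * 3) * (m * x + t) ≠ 0 :=
        mul_ne_zero (mul_ne_zero h2 (mul_ne_zero (mul_ne_zero h3 h3) h3)) hv
      intro h0
      apply h54
      simp only [eval_sub, eval_C, eval_pow, eval_X, eval_mul, derivative_sub, derivative_C,
        derivative_add, eval_add, derivative_pow, eval_ofNat, derivative_ofNat, map_ofNat,
        derivative_mul, derivative_X, Nat.cast_ofNat] at h0
      simp at h0
      rw [e1] at h0
      linear_combination -h0
    have hcard := card_roots_toFinset_of_not_sq_dvd hh0 hsimple
    obtain ⟨t₁, t₂, h12, hs⟩ := Finset.card_eq_two.mp (hcard.trans (show h.natDegree = 2 by omega))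
    have hroot : ∀ t ∈ ({t₁, t₂} : Finset K), h.IsRoot t := by
      intro t ht
      rw [← hs] at ht
      simpa [hh0] using ht
    have k1 := key t₁ (hroot t₁ (by simp))
    have k2 := key t₂ (hroot t₂ (by simp))
    by_cases hm : m = 0
    · apply hab
      rw [hap, hm]
      rw [hm] at k1
      linear_combination k1
    · apply h12
      refine mul_left_cancel₀ (mul_ne_zero (mul_ne_zero h3 h2) hm) ?_
      linear_combination k1 - k2

lemma map_cubicDisc {R S : Type*} [CommRing R] [CommRing S] (f : R →+* S) (p r s : R) :
    f (cubicDisc p r s) = cubicDisc (f p) (f r) (f s) := by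
  simp [cubicDisc, map_ofNat]

lemma cubicDisc_affine_map_not_sq {K : Type*} [Field K] (h2 : (2 : K) ≠ 0)
    {a b e v : K} (he : e ≠ 0) (hab : a ^ 2 ≠ 3 * b) (hd : cubicDisc a b (e + v ^ 2) ≠ 0)
    (c : AlgebraicClosure K) (h : (AlgebraicClosure K)[X]) :
    (cubicDisc (C a - X ^ 2) (C b - C (2 * v) * X) (C e)).map
      (algebraMap K (AlgebraicClosure K)) ≠ C c * h ^ 2 := by
  set φ := algebraMap K (AlgebraicClosure K)
  rw [← coe_mapRingHom, map_cubicDisc]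
  have := cubicDisc_affine_not_sq (K := AlgebraicClosure K) (a := φ a) (b := φ b) (e := φ e)
    (v := φ v) (by simpa [map_ofNat] using (map_ne_zero φ).mpr h2) ((map_ne_zero φ).mpr he)
    (by simpa [map_ofNat] using φ.injective.ne hab)
    (by simpa [map_cubicDisc] using (map_ne_zero φ).mpr hd) c h
  simpa [map_ofNat] using this

lemma cubicDisc_infinity_map_not_sq {K : Type*} [Field K] (h2 : (2 : K) ≠ 0)
    {a b s m : K} (hab : a ^ 2 ≠ 3 * b) (hd : cubicDisc a b s ≠ 0)
    (c : AlgebraicClosure K) (h : (AlgebraicClosure K)[X]) :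
    (cubicDisc (C (a - m ^ 2)) (C b - C (2 * m) * X) (C s - X ^ 2)).map
      (algebraMap K (AlgebraicClosure K)) ≠ C c * h ^ 2 := by
  set φ := algebraMap K (AlgebraicClosure K)
  rw [← coe_mapRingHom, map_cubicDisc]
  have := cubicDisc_infinity_not_sq (K := AlgebraicClosure K) (a := φ a) (b := φ b) (s := φ s)
    (m := φ m) (by simpa [map_ofNat] using (map_ne_zero φ).mpr h2)
    (by simpa [map_ofNat] using φ.injective.ne hab)
    (by simpa [map_cubicDisc] using (map_ne_zero φ).mpr hd) c h
  simpa [map_ofNat] using this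

lemma ringChar_ne_two_of_two_ne_zero {K : Type*} [Field K] (h2 : (2 : K) ≠ 0) :
    ringChar K ≠ 2 := by
  intro h
  have := ringChar.Nat.cast_ringChar (R := K)
  rw [h] at this
  exact h2 (by exact_mod_cast this)

lemma two_mul_card_cubic_roots_le {K : Type*} [Field K] [Fintype K] [DecidableEq K]
    (h2 : (2 : K) ≠ 0) {p r s : K}
    (hN : ¬ ∃ x y z : K, x ≠ y ∧ x ≠ z ∧ y ≠ z ∧ x ^ 3 + p * x ^ 2 + r * x + s = 0 ∧
      y ^ 3 + p * y ^ 2 + r * y + s = 0 ∧ z ^ 3 + p * z ^ 2 + r * z + s = 0) :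
    2 * ((Finset.univ.filter fun x : K => x ^ 3 + p * x ^ 2 + r * x + s = 0).card : ℤ) ≤
      1 - quadraticChar K (cubicDisc p r s) + 3 * if cubicDisc p r s = 0 then 1 else 0 := by
  set T := Finset.univ.filter fun x : K => x ^ 3 + p * x ^ 2 + r * x + s = 0 with hT
  have hcard : T.card ≤ 2 := by
    by_contra! hlt
    obtain ⟨x, y, z, hx, hy, hz, hxy, hxz, hyz⟩ := Finset.two_lt_card_iff.mp hlt
    rw [hT, Finset.mem_filter] at hx hy hz
    exact hN ⟨x, y, z, hxy, hxz, hyz, hx.2, hy.2, hz.2⟩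
  by_cases hD : cubicDisc p r s = 0
  · simp only [hD, MulChar.map_zero, if_true]
    omega
  rcases T.eq_empty_or_nonempty with hE | ⟨x, hx⟩
  · rw [hE, if_neg hD]
    rcases quadraticChar_dichotomy hD with h | h <;> simp [h]
  rw [if_neg hD]
  have hx' : x ^ 3 + p * x ^ 2 + r * x + s = 0 := by simpa [hT] using hx
  set β := p + x
  set γ := r + x * β
  have hs : s = -(x * γ) := by linear_combination hx'
  have hDf : cubicDisc p r s = (β ^ 2 - 4 * γ) * (x ^ 2 + β * x + γ) ^ 2 := by
    rw [cubicDisc, hs]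
    ring
  have hfac : ∀ y, y ^ 3 + p * y ^ 2 + r * y + s = (y - x) * (y ^ 2 + β * y + γ) := by
    intro y
    rw [hs]
    ring
  rcases quadraticChar_dichotomy hD with h | h
  · exfalso
    have hval : x ^ 2 + β * x + γ ≠ 0 := fun h0 => hD (by rw [hDf, h0]; ring)
    rw [quadraticChar_one_iff_isSquare hD, hDf] at h
    obtain ⟨w, hw⟩ := h
    obtain ⟨δ, hδ⟩ : ∃ δ, δ ^ 2 = β ^ 2 - 4 * γ :=
      ⟨w / (x ^ 2 + β * x + γ), by
        rw [div_pow, div_eq_iff (pow_ne_zero 2 hval)]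
        linear_combination -hw⟩
    have hδ0 : δ ≠ 0 := by
      rintro rfl
      exact hD (by rw [hDf, ← hδ]; ring)
    have hr : ∀ ε : K, ε ^ 2 = 1 → ((-β + ε * δ) / 2) ^ 2 + β * ((-β + ε * δ) / 2) + γ = 0 := by
      intro ε hε
      field_simp
      linear_combination δ ^ 2 * hε + hδ
    have hx1 : ∀ y, y ^ 2 + β * y + γ = 0 → x ≠ y := by
      rintro y hy rfl
      exact hval hy
    have e1 := hr 1 (by ring)
    have e2 := hr (-1) (by ring)
    refine hN ⟨x, (-β + 1 * δ) / 2, (-β + -1 * δ) / 2, hx1 _ e1, hx1 _ e2, ?_, hx', ?_, ?_⟩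
    · intro heq
      field_simp at heq
      have : 2 * δ = 0 := by linear_combination heq
      exact mul_ne_zero h2 hδ0 this
    · rw [hfac, e1, mul_zero]
    · rw [hfac, e2, mul_zero]
  · have hone : T.card ≤ 1 := by
      rw [Finset.card_le_one_iff_subset_singleton]
      refine ⟨x, fun y hy => ?_⟩
      rw [Finset.mem_singleton]
      by_contra hne
      have hy' : y ^ 3 + p * y ^ 2 + r * y + s = 0 := by simpa [hT] using hy
      rw [hfac] at hy'
      have hq := (mul_eq_zero.mp hy').resolve_left (sub_ne_zero.mpr hne)
      rw [quadraticChar_neg_one_iff_not_isSquare] at h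
      refine h ⟨(2 * y + β) * (x ^ 2 + β * x + γ), ?_⟩
      rw [hDf]
      linear_combination (-4) * (x ^ 2 + β * x + γ) ^ 2 * hq
    rw [h]
    omega

lemma two_mul_sum_card_cubic_roots_le {K : Type*} [Field K] [Fintype K] [DecidableEq K]
    (h2 : (2 : K) ≠ 0) {P R S : K[X]} {d : ℕ} (hd : (cubicDisc P R S).natDegree ≤ d)
    (hf : ∀ (c : AlgebraicClosure K) (h : (AlgebraicClosure K)[X]),
      (cubicDisc P R S).map (algebraMap K (AlgebraicClosure K)) ≠ C c * h ^ 2)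
    (hN : ∀ t, ¬ ∃ x y z : K, x ≠ y ∧ x ≠ z ∧ y ≠ z ∧
      x ^ 3 + P.eval t * x ^ 2 + R.eval t * x + S.eval t = 0 ∧
      y ^ 3 + P.eval t * y ^ 2 + R.eval t * y + S.eval t = 0 ∧
      z ^ 3 + P.eval t * z ^ 2 + R.eval t * z + S.eval t = 0) :
    2 * ((∑ t : K, (Finset.univ.filter fun x : K =>
      x ^ 3 + P.eval t * x ^ 2 + R.eval t * x + S.eval t = 0).card : ℕ) : ℝ) ≤
      Fintype.card K + ((d - 1 : ℕ) : ℝ) * √(Fintype.card K) + 3 * d := by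
  have hchar : ringChar K ≠ 2 := ringChar_ne_two_of_two_ne_zero h2
  set D := cubicDisc P R S with hD
  have hD0 : D ≠ 0 := fun h0 => hf 0 0 (by simp [h0])
  have hW := abs_sum_quadraticChar_eval_le hchar hf
  have hz : ((Finset.univ.filter fun t => D.eval t = 0).card : ℤ) ≤ d := by
    exact_mod_cast (card_filter_eval_eq_zero_le hD0).trans hd
  have hsum : 2 * ((∑ t : K, (Finset.univ.filter fun x : K =>
      x ^ 3 + P.eval t * x ^ 2 + R.eval t * x + S.eval t = 0).card : ℕ) : ℤ) ≤
      Fintype.card K - ∑ t : K, quadraticChar K (D.eval t) + 3 * d := by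
    calc _ = ∑ t : K, 2 * ((Finset.univ.filter fun x : K =>
          x ^ 3 + P.eval t * x ^ 2 + R.eval t * x + S.eval t = 0).card : ℤ) := by
          rw [← Finset.mul_sum]; push_cast; rfl
      _ ≤ ∑ t : K, (1 - quadraticChar K (D.eval t) + 3 * if D.eval t = 0 then 1 else 0) := by
          refine Finset.sum_le_sum fun t _ => ?_
          rw [hD, eval_cubicDisc]
          exact two_mul_card_cubic_roots_le h2 (hN t)
      _ = Fintype.card K - ∑ t : K, quadraticChar K (D.eval t) +
            3 * ((Finset.univ.filter fun t => D.eval t = 0).card : ℤ) := by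
          rw [Finset.sum_add_distrib, Finset.sum_sub_distrib, ← Finset.mul_sum, Finset.sum_boole]
          simp
      _ ≤ _ := by linarith
  have hsum' : 2 * ((∑ t : K, (Finset.univ.filter fun x : K =>
      x ^ 3 + P.eval t * x ^ 2 + R.eval t * x + S.eval t = 0).card : ℕ) : ℝ) ≤
      Fintype.card K - ((∑ t : K, quadraticChar K (D.eval t) : ℤ) : ℝ) + 3 * d := by
    exact_mod_cast hsum
  have hmono : ((D.natDegree - 1 : ℕ) : ℝ) * √(Fintype.card K) ≤
      ((d - 1 : ℕ) : ℝ) * √(Fintype.card K) := by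
    gcongr
  have := neg_le_of_abs_le hW
  linarith

lemma card_sub_le_card_filter_sq_eq {K : Type*} [Field K] [Fintype K] [DecidableEq K]
    (h2 : (2 : K) ≠ 0) (a b s : K) :
    (Fintype.card K : ℝ) - 2 * √(Fintype.card K) ≤
      ((Finset.univ.filter fun z : K × K =>
        z.2 ^ 2 = z.1 ^ 3 + a * z.1 ^ 2 + b * z.1 + s).card : ℝ) := by
  have hchar : ringChar K ≠ 2 := ringChar_ne_two_of_two_ne_zero h2
  set g : K[X] := X ^ 3 + C a * X ^ 2 + C b * X + C s with hg
  have hdeg : g.natDegree = 3 := by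
    rw [hg]
    compute_degree!
  have hf : ∀ (c : AlgebraicClosure K) (h : (AlgebraicClosure K)[X]),
      g.map (algebraMap K (AlgebraicClosure K)) ≠ C c * h ^ 2 := by
    intro c h heq
    have hm : (g.map (algebraMap K (AlgebraicClosure K))).natDegree = 3 := by
      rw [natDegree_map, hdeg]
    have := natDegree_C_mul_sq heq (by rintro h; simp [h] at hm)
    omega
  have hW := abs_sum_quadraticChar_eval_le hchar hf
  rw [hdeg] at hW
  have hcount : ((Finset.univ.filter fun z : K × K =>
        z.2 ^ 2 = z.1 ^ 3 + a * z.1 ^ 2 + b * z.1 + s).card : ℤ) =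
      Fintype.card K + ∑ x : K, quadraticChar K (g.eval x) := by
    rw [Finset.card_filter, ← Finset.univ_product_univ, Finset.sum_product]
    push_cast
    have : ∀ x : K, (∑ y : K, if y ^ 2 = x ^ 3 + a * x ^ 2 + b * x + s then (1 : ℤ) else 0) =
        quadraticChar K (g.eval x) + 1 := by
      intro x
      rw [← quadraticChar_card_sqrts hchar, Finset.sum_boole]
      congr 2
      ext y
      simp [hg]
    simp only [this, Finset.sum_add_distrib]
    simp [add_comm]
  have hcount' : ((Finset.univ.filter fun z : K × K =>
        z.2 ^ 2 = z.1 ^ 3 + a * z.1 ^ 2 + b * z.1 + s).card : ℝ) =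
      Fintype.card K + ((∑ x : K, quadraticChar K (g.eval x) : ℤ) : ℝ) := by
    exact_mod_cast hcount
  have := neg_le_of_abs_le hW
  rw [hcount']
  rw [show ((3 - 1 : ℕ) : ℝ) = 2 by norm_num] at this
  linarith

lemma natDegree_cubicDisc_affine_le {K : Type*} [Field K] (a b e v : K) :
    (cubicDisc (C a - X ^ 2) (C b - C (2 * v) * X) (C e)).natDegree ≤ 6 := by
  rw [cubicDisc_affine_expand]
  compute_degree

lemma natDegree_cubicDisc_infinity_le {K : Type*} [Field K] (p b s m : K) :
    (cubicDisc (C p) (C b - C (2 * m) * X) (C s - X ^ 2)).natDegree ≤ 4 := by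
  rw [cubicDisc]
  compute_degree

/-- Through a point off the curve `y² = x³ + a x² + b x + s` there is a line meeting the curve in
three points (one of them possibly the point at infinity). -/
lemma exists_secant_of_not_mem {K : Type*} [Field K] [Fintype K] [DecidableEq K]
    (h2 : (2 : K) ≠ 0) (hq : 121 ≤ Fintype.card K) {a b s : K} (hab : a ^ 2 ≠ 3 * b)
    (hd : cubicDisc a b s ≠ 0) {u v : K} (huv : v ^ 2 ≠ u ^ 3 + a * u ^ 2 + b * u + s) :
    (∃ y z : K, y ≠ z ∧ y ^ 2 = u ^ 3 + a * u ^ 2 + b * u + s ∧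
      z ^ 2 = u ^ 3 + a * u ^ 2 + b * u + s) ∨
    ∃ t x y z : K, x ≠ y ∧ x ≠ z ∧ y ≠ z ∧
      ∀ w ∈ ({x, y, z} : Set K), (v + t * (w - u)) ^ 2 = w ^ 3 + a * w ^ 2 + b * w + s := by
  by_contra! hcon
  obtain ⟨hvert, hline⟩ := hcon
  set a' := 3 * u + a with ha'
  set b' := 3 * u ^ 2 + 2 * a * u + b with hb'
  set e := u ^ 3 + a * u ^ 2 + b * u + s - v ^ 2 with he
  have hab' : a' ^ 2 ≠ 3 * b' := fun h => hab (by linear_combination h)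
  have hd' : cubicDisc a' b' (e + v ^ 2) ≠ 0 := by
    intro h
    apply hd
    rw [← h]
    simp only [cubicDisc, ha', hb', he]
    ring
  have hM := two_mul_sum_card_cubic_roots_le h2 (natDegree_cubicDisc_affine_le a' b' e v)
    (cubicDisc_affine_map_not_sq h2 (sub_ne_zero.mpr huv.symm) hab' hd') (by
      rintro t ⟨x, y, z, hxy, hxz, hyz, hx, hy, hz⟩
      obtain ⟨w, hw, hne⟩ := hline t (u + x) (u + y) (u + z) (by simpa) (by simpa) (by simpa)
      apply hne
      simp only [Set.mem_insert_iff, Set.mem_singleton_iff] at hw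
      simp only [eval_sub, eval_C, eval_pow, eval_X, eval_mul, ha', hb', he] at hx hy hz
      rcases hw with rfl | rfl | rfl
      · linear_combination -hx
      · linear_combination -hy
      · linear_combination -hz)
  have hS := card_sub_le_card_filter_sq_eq h2 a b s
  set T := Finset.univ.filter fun z : K × K => z.2 ^ 2 = z.1 ^ 3 + a * z.1 ^ 2 + b * z.1 + s with hT
  rw [← Finset.card_sigma] at hM
  have h1 : (T.filter fun z => z.1 = u).card ≤ 1 := by
    rw [Finset.card_le_one]
    rintro ⟨x, y⟩ hxy ⟨x', y'⟩ hxy'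
    simp only [hT, Finset.mem_filter, Finset.mem_univ, true_and] at hxy hxy'
    obtain ⟨h, rfl⟩ := hxy
    obtain ⟨h', rfl⟩ := hxy'
    by_contra hne
    exact hvert y y' (fun hyy => hne (by rw [hyy])) h h'
  have h2' : (T.filter fun z => ¬ z.1 = u).card ≤ (Finset.univ.sigma fun t : K =>
      Finset.univ.filter fun x : K => x ^ 3 + (C a' - X ^ 2).eval t * x ^ 2 +
        (C b' - C (2 * v) * X).eval t * x + (C e).eval t = 0).card := by
    refine Finset.card_le_card_of_injOn (fun z => ⟨(z.2 - v) / (z.1 - u), z.1 - u⟩) ?_ ?_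
    · rintro ⟨x, y⟩ hxy
      simp only [hT, Finset.coe_filter, Finset.mem_filter, Finset.mem_univ, true_and,
        Set.mem_ofPred_eq] at hxy
      obtain ⟨h, hne⟩ := hxy
      have hne' : x - u ≠ 0 := sub_ne_zero.mpr hne
      simp only [Finset.coe_sigma, Set.mem_sigma_iff, Finset.coe_univ, Set.mem_univ, true_and,
        Finset.coe_filter, Finset.mem_univ, Set.mem_ofPred_eq]
      obtain ⟨t, ht⟩ : ∃ t, t = (y - v) / (x - u) := ⟨_, rfl⟩
      have hy : y = v + t * (x - u) := by rw [ht]; field_simp; ring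
      rw [← ht]
      simp only [eval_sub, eval_C, eval_pow, eval_X, eval_mul, ha', hb', he]
      rw [hy] at h
      linear_combination -h
    · rintro ⟨x, y⟩ hxy ⟨x', y'⟩ hxy' heq
      simp only [hT, Finset.coe_filter, Finset.mem_filter, Finset.mem_univ, true_and,
        Set.mem_ofPred_eq] at hxy hxy'
      simp only [Sigma.mk.injEq, heq_eq_eq] at heq
      obtain ⟨e1, e2⟩ := heq
      have hx : x = x' := by linear_combination e2
      subst hx
      have hne' : x - u ≠ 0 := sub_ne_zero.mpr hxy.2
      have hy : y = y' := by
        rw [div_left_inj' hne'] at e1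
        linear_combination e1
      rw [hy]
  have hsplit := Finset.card_filter_add_card_filter_not (s := T) (fun z => z.1 = u)
  have hle : (T.card : ℝ) ≤ 1 + ((Finset.univ.sigma fun t : K =>
      Finset.univ.filter fun x : K => x ^ 3 + (C a' - X ^ 2).eval t * x ^ 2 +
        (C b' - C (2 * v) * X).eval t * x + (C e).eval t = 0).card : ℝ) := by
    exact_mod_cast (by omega)
  have hsq := Real.mul_self_sqrt (Nat.cast_nonneg (α := ℝ) (Fintype.card K))
  have hq' : (121 : ℝ) ≤ Fintype.card K := by exact_mod_cast hq
  have h11 : (11 : ℝ) ≤ √(Fintype.card K) := Real.le_sqrt_of_sq_le (by norm_num; exact hq)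
  simp only [Nat.cast_ofNat, Nat.reduceSub] at hM
  nlinarith

lemma exists_secant_of_slope {K : Type*} [Field K] [Fintype K] [DecidableEq K]
    (h2 : (2 : K) ≠ 0) (hq : 121 ≤ Fintype.card K) {a b s : K} (hab : a ^ 2 ≠ 3 * b)
    (hd : cubicDisc a b s ≠ 0) (m : K) :
    ∃ t x y z : K, x ≠ y ∧ x ≠ z ∧ y ≠ z ∧
      ∀ w ∈ ({x, y, z} : Set K), (m * w + t) ^ 2 = w ^ 3 + a * w ^ 2 + b * w + s := by
  by_contra! hline
  have hM := two_mul_sum_card_cubic_roots_le h2 (natDegree_cubicDisc_infinity_le (a - m ^ 2) b s m)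
    (cubicDisc_infinity_map_not_sq h2 hab hd) (by
      rintro t ⟨x, y, z, hxy, hxz, hyz, hx, hy, hz⟩
      obtain ⟨w, hw, hne⟩ := hline t x y z hxy hxz hyz
      apply hne
      simp only [Set.mem_insert_iff, Set.mem_singleton_iff] at hw
      simp only [eval_sub, eval_C, eval_pow, eval_X, eval_mul] at hx hy hz
      rcases hw with rfl | rfl | rfl
      · linear_combination -hx
      · linear_combination -hy
      · linear_combination -hz)
  have hS := card_sub_le_card_filter_sq_eq h2 a b s
  set T := Finset.univ.filter fun z : K × K => z.2 ^ 2 = z.1 ^ 3 + a * z.1 ^ 2 + b * z.1 + s with hT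
  rw [← Finset.card_sigma] at hM
  have hle : T.card ≤ (Finset.univ.sigma fun t : K =>
      Finset.univ.filter fun x : K => x ^ 3 + (C (a - m ^ 2)).eval t * x ^ 2 +
        (C b - C (2 * m) * X).eval t * x + (C s - X ^ 2).eval t = 0).card := by
    refine Finset.card_le_card_of_injOn (fun z => ⟨z.2 - m * z.1, z.1⟩) ?_ ?_
    · rintro ⟨x, y⟩ hxy
      simp only [hT, Finset.coe_filter, Finset.mem_univ, true_and, Set.mem_ofPred_eq] at hxy
      simp only [Finset.coe_sigma, Set.mem_sigma_iff, Finset.coe_univ, Set.mem_univ, true_and,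
        Finset.coe_filter, Finset.mem_univ, Set.mem_ofPred_eq]
      simp only [eval_sub, eval_C, eval_pow, eval_X, eval_mul]
      linear_combination -hxy
    · rintro ⟨x, y⟩ - ⟨x', y'⟩ - heq
      simp only [Sigma.mk.injEq, heq_eq_eq] at heq
      obtain ⟨e1, rfl⟩ := heq
      have hy : y = y' := by linear_combination e1
      rw [hy]
  have hle' : (T.card : ℝ) ≤ ((Finset.univ.sigma fun t : K =>
      Finset.univ.filter fun x : K => x ^ 3 + (C (a - m ^ 2)).eval t * x ^ 2 +
        (C b - C (2 * m) * X).eval t * x + (C s - X ^ 2).eval t = 0).card : ℝ) := by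
    exact_mod_cast hle
  have hsq := Real.mul_self_sqrt (Nat.cast_nonneg (α := ℝ) (Fintype.card K))
  have hq' : (121 : ℝ) ≤ Fintype.card K := by exact_mod_cast hq
  have h11 : (11 : ℝ) ≤ √(Fintype.card K) := Real.le_sqrt_of_sq_le (by norm_num; exact hq)
  simp only [Nat.cast_ofNat, Nat.reduceSub] at hM
  nlinarith

lemma card_filter_sq_eq_gt {K : Type*} [Field K] [Fintype K] [DecidableEq K]
    (h2 : (2 : K) ≠ 0) (hq : 121 ≤ Fintype.card K) (a b s : K) :
    98 < (Finset.univ.filter fun z : K × K =>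
      z.2 ^ 2 = z.1 ^ 3 + a * z.1 ^ 2 + b * z.1 + s).card := by
  have hS := card_sub_le_card_filter_sq_eq h2 a b s
  have hsq := Real.mul_self_sqrt (Nat.cast_nonneg (α := ℝ) (Fintype.card K))
  have hq' : (121 : ℝ) ≤ Fintype.card K := by exact_mod_cast hq
  have h11 : (11 : ℝ) ≤ √(Fintype.card K) := Real.le_sqrt_of_sq_le (by norm_num; exact hq)
  have : (98 : ℝ) < ((Finset.univ.filter fun z : K × K =>
      z.2 ^ 2 = z.1 ^ 3 + a * z.1 ^ 2 + b * z.1 + s).card : ℝ) := by nlinarith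
  exact_mod_cast this

lemma exists_vertical_secant {K : Type*} [Field K] [Fintype K] [DecidableEq K]
    (h2 : (2 : K) ≠ 0) (hq : 121 ≤ Fintype.card K) (a b s : K) :
    ∃ x y z : K, y ≠ z ∧ y ^ 2 = x ^ 3 + a * x ^ 2 + b * x + s ∧
      z ^ 2 = x ^ 3 + a * x ^ 2 + b * x + s := by
  by_contra! hcon
  have hS := card_filter_sq_eq_gt h2 hq a b s
  set g : K[X] := X ^ 3 + C a * X ^ 2 + C b * X + C s with hg
  have hdeg : g.natDegree = 3 := by
    rw [hg]
    compute_degree!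
  have hroots := card_filter_eval_eq_zero_le (f := g) (by rintro h; simp [h] at hdeg)
  rw [hdeg] at hroots
  have hy0 : ∀ x y : K, y ^ 2 = x ^ 3 + a * x ^ 2 + b * x + s → y = 0 := by
    intro x y hy
    by_contra hne
    refine hcon x y (-y) (fun h => ?_) hy (by rw [neg_sq, hy])
    exact mul_ne_zero h2 hne (by linear_combination h)
  have := Finset.card_le_card_of_injOn (s := Finset.univ.filter fun z : K × K =>
      z.2 ^ 2 = z.1 ^ 3 + a * z.1 ^ 2 + b * z.1 + s)
    (t := Finset.univ.filter fun x => g.eval x = 0) Prod.fst (by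
      rintro ⟨x, y⟩ hxy
      simp only [Finset.coe_filter, Finset.mem_univ, true_and, Set.mem_ofPred_eq] at hxy ⊢
      have := hy0 x y hxy
      rw [this] at hxy
      simp only [hg, eval_add, eval_pow, eval_X, eval_mul, eval_C]
      linear_combination -hxy) (by
      rintro ⟨x, y⟩ hxy ⟨x', y'⟩ hxy' heq
      simp only [Finset.coe_filter, Finset.mem_univ, true_and, Set.mem_ofPred_eq] at hxy hxy' heq
      rw [heq, hy0 x y hxy, hy0 x' y' hxy'])
  omega

lemma exists_secant_of_mem {K : Type*} [Field K] [Fintype K] [DecidableEq K]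
    (h2 : (2 : K) ≠ 0) (hq : 121 ≤ Fintype.card K) {a b s : K}
    (hd : cubicDisc a b s ≠ 0) {u v : K} (huv : v ^ 2 = u ^ 3 + a * u ^ 2 + b * u + s) :
    ∃ t x y z : K, x ≠ y ∧ x ≠ z ∧ y ≠ z ∧
      ∀ w ∈ ({x, y, z} : Set K), (v + t * (w - u)) ^ 2 = w ^ 3 + a * w ^ 2 + b * w + s := by
  by_contra! hline
  set a' := 3 * u + a with ha'
  set b' := 3 * u ^ 2 + 2 * a * u + b with hb'
  have hno : ∀ t x y, x ≠ 0 → y ≠ 0 → x ≠ y → x ^ 2 + (a' - t ^ 2) * x + (b' - 2 * v * t) = 0 →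
      y ^ 2 + (a' - t ^ 2) * y + (b' - 2 * v * t) = 0 → False := by
    intro t x y hx0 hy0 hxy hx hy
    obtain ⟨w, hw, hne⟩ := hline t u (u + x) (u + y) (by simpa using hx0)
      (by simpa using hy0) (by simpa)
    apply hne
    simp only [Set.mem_insert_iff, Set.mem_singleton_iff] at hw
    simp only [ha', hb'] at hx hy
    rcases hw with rfl | rfl | rfl
    · linear_combination huv
    · linear_combination huv - x * hx
    · linear_combination huv - y * hy
  have hS := card_filter_sq_eq_gt h2 hq a b s
  set T := Finset.univ.filter fun z : K × K => z.2 ^ 2 = z.1 ^ 3 + a * z.1 ^ 2 + b * z.1 + s with hT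
  have h1 : (T.filter fun z => z.1 = u).card ≤ 2 := by
    refine (Finset.card_le_card (t := {(u, v), (u, -v)}) ?_).trans Finset.card_le_two
    rintro ⟨x, y⟩ hxy
    simp only [hT, Finset.mem_filter, Finset.mem_univ, true_and] at hxy
    obtain ⟨h, rfl⟩ := hxy
    rcases sq_eq_sq_iff_eq_or_eq_neg.mp (h.trans huv.symm) with h | h <;> simp [h]
  set G : K[X] := ((C a' - X ^ 2) ^ 2 - C 4 * (C b' - C (2 * v) * X)) * (C b' - C (2 * v) * X)
    with hG
  have hGdeg : G.natDegree ≤ 5 := by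
    rw [hG]
    compute_degree
  have hG0 : G ≠ 0 := by
    rw [hG]
    refine mul_ne_zero (fun h => ?_) (fun h => ?_)
    · have h4 : ((C a' - X ^ 2) ^ 2 - C 4 * (C b' - C (2 * v) * X)).natDegree = 4 := by
        compute_degree!
      rw [h] at h4
      simp at h4
    · have hb0 := congrArg (fun p => coeff p 0) h
      have hb1 := congrArg (fun p => coeff p 1) h
      simp [coeff_C] at hb0 hb1
      have hv : v = 0 := hb1.resolve_left h2
      refine hd (cubicDisc_eq_zero_of_double_root (x := u) ?_ ?_)
      · rw [← huv, hv]; ring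
      · rw [← hb0]
  have hroots := (card_filter_eval_eq_zero_le hG0).trans hGdeg
  have hquad : ∀ x y, y ^ 2 = x ^ 3 + a * x ^ 2 + b * x + s → x ≠ u →
      (x - u) ^ 2 + (a' - ((y - v) / (x - u)) ^ 2) * (x - u) +
        (b' - 2 * v * ((y - v) / (x - u))) = 0 := by
    intro x y h hne
    have hne' : x - u ≠ 0 := sub_ne_zero.mpr hne
    obtain ⟨t, ht⟩ : ∃ t, t = (y - v) / (x - u) := ⟨_, rfl⟩
    have hy : y = v + t * (x - u) := by rw [ht]; field_simp; ring
    rw [← ht]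
    refine (mul_eq_zero.mp ?_).resolve_left hne'
    rw [hy] at h
    simp only [ha', hb']
    linear_combination huv - h
  have hcard := Finset.card_le_card_of_injOn (s := T.filter fun z => ¬ z.1 = u)
    (t := Finset.univ.filter fun t => G.eval t = 0) (fun z => (z.2 - v) / (z.1 - u)) (by
      rintro ⟨x, y⟩ hxy
      simp only [hT, Finset.coe_filter, Finset.mem_filter, Finset.mem_univ, true_and,
        Set.mem_ofPred_eq] at hxy ⊢
      have hx := hquad x y hxy.1 hxy.2
      have hne' : x - u ≠ 0 := sub_ne_zero.mpr hxy.2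
      set t := (y - v) / (x - u)
      simp only [hG, eval_sub, eval_C, eval_pow, eval_X, eval_mul]
      by_contra hne
      obtain ⟨hδ, hr⟩ := mul_ne_zero_iff.mp hne
      refine hno t (x - u) (-(a' - t ^ 2) - (x - u)) hne' (fun h0 => ?_) (fun h0 => ?_) hx ?_
      · apply hr
        linear_combination hx + (x - u) * h0
      · apply hδ
        have h5 : a' - t ^ 2 = -2 * (x - u) := by linear_combination h0
        rw [h5] at hx ⊢
        linear_combination -4 * hx
      · linear_combination hx) (by
      rintro ⟨x, y⟩ hxy ⟨x', y'⟩ hxy' heq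
      simp only [hT, Finset.coe_filter, Finset.mem_filter, Finset.mem_univ, true_and,
        Set.mem_ofPred_eq] at hxy hxy' heq
      have e1 := hquad x y hxy.1 hxy.2
      have e2 := hquad x' y' hxy'.1 hxy'.2
      rw [← heq] at e2
      have hxx : x = x' := by
        by_contra hne
        exact hno _ _ _ (sub_ne_zero.mpr hxy.2) (sub_ne_zero.mpr hxy'.2)
          (fun h => hne (by linear_combination h)) e1 e2
      subst hxx
      rw [div_left_inj' (sub_ne_zero.mpr hxy.2)] at heq
      have hy : y = y' := by linear_combination heq
      rw [hy])
  have hsplit := Finset.card_filter_add_card_filter_not (s := T) (fun z => z.1 = u)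
  omega

lemma sum_mul_phiVec_zero (W : WeierstrassCurve F) (a : Fin 3 → F) :
    ∑ i, a i * phiVec W 3 .zero i = a 2 := by
  simp [Fin.sum_univ_three, phiVec]

lemma sum_mul_phiVec_some (W : WeierstrassCurve F) (a : Fin 3 → F) {x y : F}
    (h : W.toAffine.Nonsingular x y) :
    ∑ i, a i * phiVec W 3 (.some x y h) i = a 0 + a 1 * x + a 2 * y := by
  simp [Fin.sum_univ_three, phiVec, psi]

lemma two_ne_zero_of_odd_card (hodd : Odd (Fintype.card F)) : (2 : F) ≠ 0 := by
  intro h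
  have hc : ringChar F = 2 := by
    have h1 : ringChar F ∣ 2 := ringChar.dvd (by exact_mod_cast h)
    exact (Nat.prime_dvd_prime_iff_eq (CharP.char_is_prime F (ringChar F)) Nat.prime_two).1 h1
  have := FiniteField.even_card_of_char_two hc
  rw [Nat.odd_iff] at hodd
  omega

/-- Completing the square in the Weierstrass equation. -/
lemma nonsingular_iff_sq_eq (W : WeierstrassCurve F) [W.IsElliptic] (h2 : (2 : F) ≠ 0) (x y : F) :
    W.toAffine.Nonsingular x y ↔ (y + (W.a₁ * x + W.a₃) / 2) ^ 2 =
      x ^ 3 + (W.a₂ + W.a₁ ^ 2 / 4) * x ^ 2 + (W.a₄ + W.a₁ * W.a₃ / 2) * x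
        + (W.a₆ + W.a₃ ^ 2 / 4) := by
  have h4 : (4 : F) ≠ 0 := by
    have : (4 : F) = 2 * 2 := by norm_num
    rw [this]; exact mul_ne_zero h2 h2
  rw [← Affine.equation_iff_nonsingular, Affine.equation_iff]
  have e : (4 : F) = 2 * 2 := by norm_num
  constructor
  · intro h
    rw [e]
    field_simp
    linear_combination 4 * h
  · intro h
    rw [e] at h
    field_simp at h
    refine mul_left_cancel₀ h4 ?_
    linear_combination h

lemma cubicDisc_ne_zero (W : WeierstrassCurve F) [W.IsElliptic] (h2 : (2 : F) ≠ 0) :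
    cubicDisc (W.a₂ + W.a₁ ^ 2 / 4) (W.a₄ + W.a₁ * W.a₃ / 2) (W.a₆ + W.a₃ ^ 2 / 4) ≠ 0 := by
  intro h
  apply W.isUnit_Δ.ne_zero
  have : W.Δ = 16 * cubicDisc (W.a₂ + W.a₁ ^ 2 / 4) (W.a₄ + W.a₁ * W.a₃ / 2)
      (W.a₆ + W.a₃ ^ 2 / 4) := by
    have e : (4 : F) = 2 * 2 := by norm_num
    simp only [WeierstrassCurve.Δ, WeierstrassCurve.b₂, WeierstrassCurve.b₄, WeierstrassCurve.b₆,
      WeierstrassCurve.b₈, cubicDisc]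
    have : W.a₁ ^ 2 / 4 = (W.a₁ / 2) ^ 2 := by rw [e]; field_simp
    rw [this]
    have : W.a₃ ^ 2 / 4 = (W.a₃ / 2) ^ 2 := by rw [e]; field_simp
    rw [this]
    have : W.a₁ * W.a₃ / 2 = 2 * (W.a₁ / 2) * (W.a₃ / 2) := by field_simp
    rw [this]
    obtain ⟨s, hs⟩ : ∃ s, s = W.a₁ / 2 := ⟨_, rfl⟩
    obtain ⟨t, ht⟩ : ∃ t, t = W.a₃ / 2 := ⟨_, rfl⟩
    have hs' : W.a₁ = 2 * s := by rw [hs]; field_simp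
    have ht' : W.a₃ = 2 * t := by rw [ht]; field_simp
    rw [← hs, ← ht, hs', ht']
    ring
  rw [this, h, mul_zero]

lemma sq_ne_three_mul (W : WeierstrassCurve F) [W.IsElliptic] (h2 : (2 : F) ≠ 0) (hj : W.j ≠ 0) :
    (W.a₂ + W.a₁ ^ 2 / 4) ^ 2 ≠ 3 * (W.a₄ + W.a₁ * W.a₃ / 2) := by
  intro h
  apply hj
  rw [WeierstrassCurve.j_eq_zero_iff]
  have e : (4 : F) = 2 * 2 := by norm_num
  rw [e] at h
  field_simp at h
  simp only [WeierstrassCurve.c₄, WeierstrassCurve.b₂, WeierstrassCurve.b₄]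
  linear_combination h

/-- Three points with distinct abscissae on a non-vertical line. -/
lemma exists_points_of_line (W : WeierstrassCurve F) [W.IsElliptic] (h2 : (2 : F) ≠ 0)
    {α τ x y z : F} (hxy : x ≠ y) (hxz : x ≠ z) (hyz : y ≠ z)
    (h : ∀ w ∈ ({x, y, z} : Set F), (α + τ * w) ^ 2 =
      w ^ 3 + (W.a₂ + W.a₁ ^ 2 / 4) * w ^ 2 + (W.a₄ + W.a₁ * W.a₃ / 2) * w
        + (W.a₆ + W.a₃ ^ 2 / 4)) :
    ∃ P₁ P₂ P₃ : W.toAffine.Point, P₁ ≠ P₂ ∧ P₁ ≠ P₃ ∧ P₂ ≠ P₃ ∧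
      ∀ P ∈ ({P₁, P₂, P₃} : Set W.toAffine.Point),
        ∑ i, (![W.a₃ / 2 - α, W.a₁ / 2 - τ, 1] : Fin 3 → F) i * phiVec W 3 P i = 0 := by
  have key : ∀ w ∈ ({x, y, z} : Set F),
      W.toAffine.Nonsingular w (α + τ * w - (W.a₁ * w + W.a₃) / 2) := by
    intro w hw
    rw [nonsingular_iff_sq_eq W h2, sub_add_cancel]
    exact h w hw
  refine ⟨.some x _ (key x (by simp)), .some y _ (key y (by simp)), .some z _ (key z (by simp)),
    ?_, ?_, ?_, ?_⟩
  · simp [hxy]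
  · simp [hxz]
  · simp [hyz]
  · rintro P (rfl | rfl | rfl) <;> rw [sum_mul_phiVec_some] <;> simp <;> ring

/-- Two points with the same abscissa and the point at infinity on a vertical line. -/
lemma exists_points_of_vertical (W : WeierstrassCurve F) [W.IsElliptic] (h2 : (2 : F) ≠ 0)
    {u y z : F} (hyz : y ≠ z)
    (hy : y ^ 2 = u ^ 3 + (W.a₂ + W.a₁ ^ 2 / 4) * u ^ 2 + (W.a₄ + W.a₁ * W.a₃ / 2) * u
        + (W.a₆ + W.a₃ ^ 2 / 4))
    (hz : z ^ 2 = u ^ 3 + (W.a₂ + W.a₁ ^ 2 / 4) * u ^ 2 + (W.a₄ + W.a₁ * W.a₃ / 2) * u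
        + (W.a₆ + W.a₃ ^ 2 / 4)) :
    ∃ P₁ P₂ P₃ : W.toAffine.Point, P₁ ≠ P₂ ∧ P₁ ≠ P₃ ∧ P₂ ≠ P₃ ∧
      ∀ P ∈ ({P₁, P₂, P₃} : Set W.toAffine.Point),
        ∑ i, (![-u, 1, 0] : Fin 3 → F) i * phiVec W 3 P i = 0 := by
  have hy' : W.toAffine.Nonsingular u (y - (W.a₁ * u + W.a₃) / 2) := by
    rwa [nonsingular_iff_sq_eq W h2, sub_add_cancel]
  have hz' : W.toAffine.Nonsingular u (z - (W.a₁ * u + W.a₃) / 2) := by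
    rwa [nonsingular_iff_sq_eq W h2, sub_add_cancel]
  refine ⟨.zero, .some u _ hy', .some u _ hz', ?_, ?_, ?_, ?_⟩
  · intro h; cases h
  · intro h; cases h
  · simp [hyz]
  · rintro P (rfl | rfl | rfl)
    · rw [sum_mul_phiVec_zero]; simp
    · rw [sum_mul_phiVec_some]; simp
    · rw [sum_mul_phiVec_some]; simp

/-- Every point of the plane lies on a line through three rational points of the curve. -/
lemma exists_trisecant (hq : 121 ≤ Fintype.card F) (h2 : (2 : F) ≠ 0)
    (W : WeierstrassCurve F) [W.IsElliptic] (hj : W.j ≠ 0) (Q : Fin 3 → F) :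
    ∃ a : Fin 3 → F, a ≠ 0 ∧ ∑ i, a i * Q i = 0 ∧
      ∃ P₁ P₂ P₃ : W.toAffine.Point, P₁ ≠ P₂ ∧ P₁ ≠ P₃ ∧ P₂ ≠ P₃ ∧
        ∀ P ∈ ({P₁, P₂, P₃} : Set W.toAffine.Point), ∑ i, a i * phiVec W 3 P i = 0 := by
  have hd := cubicDisc_ne_zero W h2
  have hab := sq_ne_three_mul W h2 hj
  have line_ne : ∀ b c : F, (![b, c, 1] : Fin 3 → F) ≠ 0 := fun b c h => by
    simpa using congrFun h 2
  have vert_ne : ∀ b : F, (![b, 1, 0] : Fin 3 → F) ≠ 0 := fun b h => by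
    simpa using congrFun h 1
  by_cases h0 : Q 0 = 0
  · by_cases h1 : Q 1 = 0
    · obtain ⟨x, y, z, hyz, hy, hz⟩ := exists_vertical_secant h2 hq
        (W.a₂ + W.a₁ ^ 2 / 4) (W.a₄ + W.a₁ * W.a₃ / 2) (W.a₆ + W.a₃ ^ 2 / 4)
      exact ⟨_, vert_ne _, by simp [Fin.sum_univ_three, h0, h1],
        exists_points_of_vertical W h2 hyz hy hz⟩
    · obtain ⟨t, x, y, z, hxy, hxz, hyz, h⟩ :=
        exists_secant_of_slope h2 hq hab hd (W.a₁ / 2 + Q 2 / Q 1)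
      refine ⟨_, line_ne _ _, ?_, exists_points_of_line W h2 (α := t)
        (τ := W.a₁ / 2 + Q 2 / Q 1) hxy hxz hyz fun w hw => ?_⟩
      · simp [Fin.sum_univ_three, h0]
        field_simp
        ring
      · rw [add_comm]; exact h w hw
  · set u := Q 1 / Q 0 with hu
    set v := Q 2 / Q 0 + (W.a₁ * u + W.a₃) / 2 with hv
    have hline : ∀ t x y z, x ≠ y → x ≠ z → y ≠ z →
        (∀ w ∈ ({x, y, z} : Set F), (v + t * (w - u)) ^ 2 =
          w ^ 3 + (W.a₂ + W.a₁ ^ 2 / 4) * w ^ 2 + (W.a₄ + W.a₁ * W.a₃ / 2) * w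
            + (W.a₆ + W.a₃ ^ 2 / 4)) →
        ∃ a : Fin 3 → F, a ≠ 0 ∧ ∑ i, a i * Q i = 0 ∧
          ∃ P₁ P₂ P₃ : W.toAffine.Point, P₁ ≠ P₂ ∧ P₁ ≠ P₃ ∧ P₂ ≠ P₃ ∧
            ∀ P ∈ ({P₁, P₂, P₃} : Set W.toAffine.Point), ∑ i, a i * phiVec W 3 P i = 0 := by
      intro t x y z hxy hxz hyz h
      refine ⟨_, line_ne _ _, ?_, exists_points_of_line W h2 (α := v - t * u)
        (τ := t) hxy hxz hyz fun w hw => ?_⟩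
      · simp [Fin.sum_univ_three, hv, hu]
        field_simp
        ring
      · rw [← h w hw]; ring
    by_cases huv : v ^ 2 = u ^ 3 + (W.a₂ + W.a₁ ^ 2 / 4) * u ^ 2
        + (W.a₄ + W.a₁ * W.a₃ / 2) * u + (W.a₆ + W.a₃ ^ 2 / 4)
    · obtain ⟨t, x, y, z, hxy, hxz, hyz, h⟩ := exists_secant_of_mem h2 hq hd huv
      exact hline t x y z hxy hxz hyz h
    · obtain ⟨y, z, hyz, hy, hz⟩ | ⟨t, x, y, z, hxy, hxz, hyz, h⟩ :=
        exists_secant_of_not_mem h2 hq hab hd huv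
      · refine ⟨_, vert_ne _, ?_, exists_points_of_vertical W h2 hyz hy hz⟩
        simp [Fin.sum_univ_three, hu]
        field_simp
        ring
      · exact hline t x y z hxy hxz hyz h

instance finite_point (W : WeierstrassCurve F) : Finite W.toAffine.Point := by
  refine Finite.of_injective (β := Option (F × F))
    (fun P => match P with | .zero => none | .some x y _ => some (x, y)) ?_
  rintro (_ | ⟨x, y, h⟩) (_ | ⟨x', y', h'⟩) <;> simp

/-- A line contains at most three points of the curve. -/
lemma ncard_line_le_three (W : WeierstrassCurve F) {a : Fin 3 → F} (ha : a ≠ 0) :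
    {P : W.toAffine.Point | ∑ i, a i * phiVec W 3 P i = 0}.ncard ≤ 3 := by
  by_cases h2 : a 2 = 0
  · by_cases h1 : a 1 = 0
    · have h0 : a 0 ≠ 0 := fun h0 => ha (by ext i; fin_cases i <;> simp [h0, h1, h2])
      have : {P : W.toAffine.Point | ∑ i, a i * phiVec W 3 P i = 0} ⊆ {.zero} := by
        rintro (_ | ⟨x, y, h⟩) hP
        · rfl
        · rw [Set.mem_ofPred_eq, sum_mul_phiVec_some] at hP
          simp [h1, h2, h0] at hP
      exact (Set.ncard_le_ncard this).trans (by simp)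
    · set x₀ := -a 0 / a 1 with hx₀
      set f : F[X] := X ^ 2 + (C (W.a₁ * x₀ + W.a₃) * X
        - C (x₀ ^ 3 + W.a₂ * x₀ ^ 2 + W.a₄ * x₀ + W.a₆)) with hf
      have hdeg : f.natDegree = 2 := by rw [hf]; compute_degree!
      have hf0 : f ≠ 0 := fun h => by simp [h] at hdeg
      let yc : W.toAffine.Point → F := fun P => match P with | .zero => 0 | .some _ y _ => y
      have hx : ∀ x y (h : W.toAffine.Nonsingular x y),
          ∑ i, a i * phiVec W 3 (.some x y h) i = 0 → x = x₀ := by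
        intro x y h hP
        rw [sum_mul_phiVec_some, h2] at hP
        rw [hx₀]
        field_simp
        linear_combination hP
      have hsub : {P : W.toAffine.Point | ∑ i, a i * phiVec W 3 P i = 0} ⊆
          insert .zero ({P : W.toAffine.Point | ∑ i, a i * phiVec W 3 P i = 0} \ {.zero}) := by
        intro P hP
        by_cases h : P = .zero
        · simp [h]
        · exact Set.mem_insert_of_mem _ ⟨hP, h⟩
      have hcard : ({P : W.toAffine.Point | ∑ i, a i * phiVec W 3 P i = 0} \ {.zero}).ncard ≤
          ((Finset.univ.filter fun y => f.eval y = 0 : Finset F) : Set F).ncard := by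
        refine Set.ncard_le_ncard_of_injOn yc ?_ ?_ (Set.toFinite _)
        · rintro (_ | ⟨x, y, h⟩) ⟨hP, hP0⟩
          · exact absurd rfl hP0
          · obtain rfl : x = x₀ := hx _ _ h hP
            have := (Affine.equation_iff _ _).1 h.1
            simp [yc, hf]
            linear_combination this
        · rintro (_ | ⟨x, y, h⟩) ⟨hP, hP0⟩ (_ | ⟨x', y', h'⟩) ⟨hP', hP0'⟩ hyy
          · rfl
          · exact absurd rfl hP0
          · exact absurd rfl hP0'
          · have := hx _ _ h hP
            have := hx _ _ h' hP'
            have : y = y' := hyy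
            simp_all
      rw [Set.ncard_coe_finset] at hcard
      have := card_filter_eval_eq_zero_le hf0
      have := (Set.ncard_le_ncard hsub).trans (Set.ncard_insert_le _ _)
      omega
  · set c := -a 0 / a 2 with hc
    set d := -a 1 / a 2 with hd
    set f : F[X] := X ^ 3 + (C (W.a₂ - d ^ 2 - W.a₁ * d) * X ^ 2
      + C (W.a₄ - 2 * c * d - W.a₁ * c - W.a₃ * d) * X + C (W.a₆ - c ^ 2 - W.a₃ * c)) with hf
    have hdeg : f.natDegree = 3 := by rw [hf]; compute_degree!
    have hf0 : f ≠ 0 := fun h => by simp [h] at hdeg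
    let xc : W.toAffine.Point → F := fun P => match P with | .zero => 0 | .some x _ _ => x
    have hy : ∀ x y (h : W.toAffine.Nonsingular x y),
        ∑ i, a i * phiVec W 3 (.some x y h) i = 0 → y = c + d * x := by
      intro x y h hP
      rw [sum_mul_phiVec_some] at hP
      rw [hc, hd]
      field_simp
      linear_combination hP
    have hcard : {P : W.toAffine.Point | ∑ i, a i * phiVec W 3 P i = 0}.ncard ≤
        ((Finset.univ.filter fun x => f.eval x = 0 : Finset F) : Set F).ncard := by
      refine Set.ncard_le_ncard_of_injOn xc ?_ ?_ (Set.toFinite _)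
      · rintro (_ | ⟨x, y, h⟩) hP
        · exact absurd ((sum_mul_phiVec_zero W a).symm.trans hP) h2
        · have hyx := hy _ _ h hP
          have := (Affine.equation_iff _ _).1 h.1
          rw [hyx] at this
          simp [xc, hf]
          linear_combination -this
      · rintro (_ | ⟨x, y, h⟩) hP (_ | ⟨x', y', h'⟩) hP' hxx
        · rfl
        · exact absurd ((sum_mul_phiVec_zero W a).symm.trans hP) h2
        · exact absurd ((sum_mul_phiVec_zero W a).symm.trans hP') h2
        · have := hy _ _ h hP
          have := hy _ _ h' hP'
          have : x = x' := hxx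
          simp_all
    rw [Set.ncard_coe_finset] at hcard
    have := card_filter_eval_eq_zero_le hf0
    omega

lemma card_point_gt_three (hq : 121 ≤ Fintype.card F) (h2 : (2 : F) ≠ 0)
    (W : WeierstrassCurve F) [W.IsElliptic] : 3 < Nat.card W.toAffine.Point := by
  have h := card_filter_sq_eq_gt h2 hq
    (W.a₂ + W.a₁ ^ 2 / 4) (W.a₄ + W.a₁ * W.a₃ / 2) (W.a₆ + W.a₃ ^ 2 / 4)
  rw [← Fintype.card_coe, ← Nat.card_eq_fintype_card] at h
  refine (by norm_num : 3 < 98).trans (h.trans_le ?_)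
  refine Nat.card_le_card_of_injective
    (fun z => .some z.1.1 (z.1.2 - (W.a₁ * z.1.1 + W.a₃) / 2) ?_) ?_
  · rw [nonsingular_iff_sq_eq W h2, sub_add_cancel]
    exact (Finset.mem_filter.1 z.2).2
  · rintro ⟨⟨x, y⟩, h⟩ ⟨⟨x', y'⟩, h'⟩ hz
    simp only [Affine.Point.some.injEq] at hz
    obtain ⟨rfl, hy⟩ := hz
    simpa using hy

lemma onHyp_mk (a : Fin 3 → F) {v : Fin 3 → F} (hv : v ≠ 0) :
    OnHyp a (Projectivization.mk F v hv) ↔ ∑ i, a i * v i = 0 := by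
  obtain ⟨c, hc⟩ := Projectivization.exists_smul_eq_mk_rep F v hv
  have : ∑ i, a i * (Projectivization.mk F v hv).rep i = c * ∑ i, a i * v i := by
    rw [← hc, Finset.mul_sum]
    exact Finset.sum_congr rfl fun i _ => by
      rw [Pi.smul_apply, Units.smul_def, smul_eq_mul, mul_left_comm]
  rw [OnHyp, this]
  simp

lemma phiProj_injective (W : WeierstrassCurve F) (h3 : 0 < 3) :
    Function.Injective (phiProj W (k := 3) h3) := by
  intro P P' h
  obtain ⟨c, hc⟩ := (Projectivization.mk_eq_mk_iff' F _ _ _ _).1 h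
  have h0 := congrFun hc 0
  have h1 := congrFun hc 1
  have h2 := congrFun hc 2
  rcases P with _ | ⟨x, y, hP⟩ <;> rcases P' with _ | ⟨x', y', hP'⟩ <;>
    simp [phiVec, psi] at h0 h1 h2
  · rfl
  · simp [h0] at h2
  · subst h0
    simp at h1 h2
    simp [h1, h2]

lemma setOf_onHyp_eq_image (W : WeierstrassCurve F) (h3 : 0 < 3) (a : Fin 3 → F) :
    {p ∈ Set.range (phiProj W (k := 3) h3) | OnHyp a p} =
      Set.image (phiProj W (k := 3) h3) {P | ∑ i, a i * phiVec W 3 P i = 0} := by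
  ext p
  constructor
  · rintro ⟨⟨P, rfl⟩, hP⟩
    exact ⟨P, (onHyp_mk a _).1 hP, rfl⟩
  · rintro ⟨P, hP, rfl⟩
    exact ⟨⟨P, rfl⟩, (onHyp_mk a _).2 hP⟩

lemma ncard_onHyp_eq (W : WeierstrassCurve F) (h3 : 0 < 3) (a : Fin 3 → F) :
    {p ∈ Set.range (phiProj W (k := 3) h3) | OnHyp a p}.ncard =
      {P : W.toAffine.Point | ∑ i, a i * phiVec W 3 P i = 0}.ncard := by
  rw [setOf_onHyp_eq_image, Set.ncard_image_of_injective _ (phiProj_injective W h3)]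

lemma exists_line_ncard_eq_three (hq : 121 ≤ Fintype.card F) (h2 : (2 : F) ≠ 0)
    (W : WeierstrassCurve F) [W.IsElliptic] (hj : W.j ≠ 0) (Q : Fin 3 → F) :
    ∃ a : Fin 3 → F, a ≠ 0 ∧ ∑ i, a i * Q i = 0 ∧
      {P : W.toAffine.Point | ∑ i, a i * phiVec W 3 P i = 0}.ncard = 3 := by
  obtain ⟨a, ha, haQ, P₁, P₂, P₃, h12, h13, h23, h⟩ := exists_trisecant hq h2 W hj Q
  refine ⟨a, ha, haQ, (ncard_line_le_three W ha).antisymm ?_⟩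
  exact (Set.ncard_eq_three.2 ⟨P₁, P₂, P₃, h12, h13, h23, rfl⟩).ge.trans (Set.ncard_le_ncard h)

lemma hammingNorm_add_ncard {n : ℕ} (x : Fin n → F) : hammingNorm x + {i | x i = 0}.ncard = n := by
  have h := Finset.card_filter_add_card_filter_not (s := Finset.univ) (p := fun i => x i ≠ 0)
  have h0 : {i | x i = 0}.ncard = (Finset.univ.filter fun i => ¬ x i ≠ 0).card := by
    rw [← Set.ncard_coe_finset]
    congr 1
    ext i
    simp
  rw [h0, hammingNorm, h]
  simp

/-- The zeros of a codeword are the points of the curve on the corresponding line. -/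
lemma ncard_zeros_combination (W : WeierstrassCurve F) {n : ℕ} (e : Fin n ≃ W.toAffine.Point)
    (a : Fin 3 → F) :
    {j | ∑ i, a i * phiVec W 3 (e j) i = 0}.ncard =
      {P : W.toAffine.Point | ∑ i, a i * phiVec W 3 P i = 0}.ncard := by
  rw [← Set.ncard_image_of_injective _ e.injective]
  congr 1
  ext P
  constructor
  · rintro ⟨j, hj, rfl⟩
    exact hj
  · intro hP
    exact ⟨e.symm P, by simpa using hP, by simp⟩

lemma le_minDist_ellipticCode (W : WeierstrassCurve F) {n : ℕ} (e : Fin n ≃ W.toAffine.Point)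
    (hne : ∃ x ∈ ellipticCode W 3 e, x ≠ 0) : n ≤ minDist (ellipticCode W 3 e) + 3 := by
  obtain ⟨x₀, hx₀, hx₀'⟩ := hne
  obtain ⟨x, hx, hx0, hd⟩ := Nat.sInf_mem
    (s := {d | ∃ x ∈ ellipticCode W 3 e, x ≠ 0 ∧ hammingNorm x = d}) ⟨_, x₀, hx₀, hx₀', rfl⟩
  rw [minDist, ← hd]
  obtain ⟨a, rfl⟩ := (Submodule.mem_span_range_iff_exists_fun F).1 hx
  have ha : a ≠ 0 := by
    rintro rfl
    simp at hx0
  have h1 := hammingNorm_add_ncard (∑ i, a i • fun j : Fin n => phiVec W 3 (e j) i)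
  have h2 := ncard_line_le_three W ha
  rw [← ncard_zeros_combination W e] at h2
  simp only [Finset.sum_apply, Pi.smul_apply, smul_eq_mul] at h1
  omega

lemma not_isHExtendable_ellipticCode (hq : 121 ≤ Fintype.card F) (h2 : (2 : F) ≠ 0)
    (W : WeierstrassCurve F) [W.IsElliptic] (hj : W.j ≠ 0) {n : ℕ}
    (e : Fin n ≃ W.toAffine.Point) : ¬ IsHExtendable 1 (ellipticCode W 3 e) := by
  rintro ⟨C', -, hdist, hmap⟩
  have hrow : ∀ i : Fin 3, ∃ w ∈ C', ∀ j : Fin n, w (Fin.castAdd 1 j) = phiVec W 3 (e j) i := by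
    intro i
    have : (fun j : Fin n => phiVec W 3 (e j) i) ∈ ellipticCode W 3 e :=
      Submodule.subset_span ⟨i, rfl⟩
    rw [← hmap] at this
    obtain ⟨w, hw, hwi⟩ := this
    exact ⟨w, hw, fun j => congrFun hwi j⟩
  choose w hwC hw using hrow
  obtain ⟨a, ha, haQ, hcard⟩ := exists_line_ncard_eq_three hq h2 W hj fun i => w i (Fin.last n)
  set c : Fin (n + 1) → F := ∑ i, a i • w i with hc
  have hcC : c ∈ C' := Submodule.sum_mem _ fun i _ => C'.smul_mem _ (hwC i)
  have hlast : c (Fin.last n) = 0 := by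
    simpa [hc] using haQ
  have hcast : ∀ j : Fin n, c (Fin.castAdd 1 j) = ∑ i, a i * phiVec W 3 (e j) i := by
    intro j
    simp only [hc, Finset.sum_apply, Pi.smul_apply, smul_eq_mul, hw]
  have hn : Nat.card W.toAffine.Point = n := by
    rw [← Nat.card_congr e, Nat.card_fin]
  have hn3 := card_point_gt_three hq h2 W
  rw [← ncard_zeros_combination W e] at hcard
  have hres : (fun j : Fin n => c (Fin.castAdd 1 j)) ∈ ellipticCode W 3 e := by
    rw [← hmap]
    exact ⟨c, hcC, rfl⟩
  have hres0 : (fun j : Fin n => c (Fin.castAdd 1 j)) ≠ 0 := by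
    intro h
    have : {j | ∑ i, a i * phiVec W 3 (e j) i = 0} = Set.univ := by
      ext j
      simpa [← hcast j] using congrFun h j
    rw [this, Set.ncard_univ, Nat.card_fin] at hcard
    omega
  have hc0 : c ≠ 0 := fun h => hres0 (by simp [h]; rfl)
  have hge := le_minDist_ellipticCode W e ⟨_, hres, hres0⟩
  have hle : minDist C' ≤ hammingNorm c := Nat.sInf_le ⟨c, hcC, hc0, rfl⟩
  have hsum := hammingNorm_add_ncard c
  have hzeros : insert (Fin.last n)
      (Set.image (Fin.castAdd 1) {j : Fin n | ∑ i, a i * phiVec W 3 (e j) i = 0}) ⊆ {j | c j = 0} := by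
    rintro j (rfl | ⟨j, hj, rfl⟩)
    · exact hlast
    · exact (hcast j).trans hj
  have hcount := Set.ncard_le_ncard hzeros
  rw [Set.ncard_insert_of_notMem, Set.ncard_image_of_injective _ (Fin.castAdd_injective n 1),
    hcard] at hcount
  · omega
  · rintro ⟨j, -, hj⟩
    exact (Fin.castSucc_lt_last j).ne hj

end

/-- Let `q ≥ 121` be an odd prime power and `E/F_q` an elliptic curve with
`j(E) ≠ 0`. Then the `3`-elliptic code associated to `E` is non-extendable; equivalently
`φ₃(E(F_q))` is a complete `(n; 3, 1)`-set in `P²(F_q)`: through every `F_q`-rational point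
not on it there is a line meeting it in `3` points. -/
theorem statement11 (hq : 121 ≤ Fintype.card F) (hodd : Odd (Fintype.card F))
    (W : WeierstrassCurve F) [W.IsElliptic] (hj : W.j ≠ 0) {n : ℕ}
    (hn : n = Nat.card W.toAffine.Point) (e : Fin n ≃ W.toAffine.Point) :
    ¬ IsHExtendable 1 (ellipticCode W 3 e) ∧
      IsCompleteArcSet 3 (Set.range (phiProj W (k := 3) (by norm_num))) ∧
      ∀ Q ∉ Set.range (phiProj W (k := 3) (by norm_num)),
        ∃ a : Fin 3 → F, a ≠ 0 ∧ OnHyp a Q ∧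
          Set.ncard {p ∈ Set.range (phiProj W (k := 3) (by norm_num)) | OnHyp a p} = 3 := by
  have h2 := two_ne_zero_of_odd_card hodd
  have hsecant : ∀ Q : Projectivization F (Fin 3 → F), ∃ a : Fin 3 → F, a ≠ 0 ∧ OnHyp a Q ∧
      Set.ncard {p ∈ Set.range (phiProj W (k := 3) (by norm_num)) | OnHyp a p} = 3 := by
    intro Q
    obtain ⟨a, ha, haQ, hcard⟩ := exists_line_ncard_eq_three hq h2 W hj Q.rep
    exact ⟨a, ha, haQ, (ncard_onHyp_eq W _ a).trans hcard⟩
  refine ⟨not_isHExtendable_ellipticCode hq h2 W hj e, ⟨fun a ha => ?_, fun T hT hST => ?_⟩,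
    fun Q _ => hsecant Q⟩
  · rw [ncard_onHyp_eq]
    exact ncard_line_le_three W ha
  · refine (Set.Subset.antisymm hST fun Q hQT => ?_).symm
    by_contra hQ
    obtain ⟨a, ha, haQ, hcard⟩ := hsecant Q
    have hsub : insert Q {p ∈ Set.range (phiProj W (k := 3) (by norm_num)) | OnHyp a p} ⊆
        {p ∈ T | OnHyp a p} := by
      rintro p (rfl | ⟨hp, hpa⟩)
      · exact ⟨hQT, haQ⟩
      · exact ⟨hST hp, hpa⟩
    have hle := (Set.ncard_le_ncard hsub).trans (hT a ha)
    rw [Set.ncard_insert_of_notMem fun h => hQ h.1, hcard] at hle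
    omega

end NMDS
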